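/- arXiv:2101.12353 — 4 statements merged into one kernel-verified Lean document; each statement's English description precedes it below -/
import Mathlib

section
/- Let $p \in [1,\infty)$ and let $\mu$ be a probability measure on $\mathbb{R}^d$. If $t < d_*(\mu)$, then there exists a constant $C_\mu > 0$ depending on $\mu$ (and $t$, $p$) such that for all sufficiently large $n$, $\inf_{\gamma \in \mathcal{P}(n)} W_p(\mu, \gamma) \ge C_\mu n^{-1/t}$. -/
open MeasureTheory Filter Topology Metric Set
open scoped ENNReal NNReal

noncomputable section

/-! ### ReLU neural networks -/

/-- Forward pass of a ReLU network: `nnForward N M b l x` is the output of the `l`-th hidden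
layer (after applying the ReLU) on input `x`. Here `N l` is the number of neurons in layer `l`,
`M l` and `b l` are the weight matrix and the bias vector of the affine map `A_l`. -/
def nnForward (N : ℕ → ℕ)
    (M : ∀ l : ℕ, Matrix (Fin (N (l + 1))) (Fin (N l)) ℝ)
    (b : ∀ l : ℕ, Fin (N (l + 1)) → ℝ) :
    ∀ l : ℕ, (Fin (N 0) → ℝ) → Fin (N l) → ℝ
  | 0 => fun x => x
  | l + 1 => fun x i => max ((M l).mulVec (nnForward N M b l x) i + b l i) 0

/-- `NNset m d W L` is the set of functions `ℝ^m → ℝ^d` that are representable by ReLU neural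
networks with width at most `W` and depth (number of hidden layers) at most `L`. -/
def NNset (m d W L : ℕ) : Set (EuclideanSpace ℝ (Fin m) → EuclideanSpace ℝ (Fin d)) :=
  {φ | ∃ L' : ℕ, 1 ≤ L' ∧ L' ≤ L ∧
    ∃ (N : ℕ → ℕ) (h0 : N 0 = m) (hL : N (L' + 1) = d),
      (∀ l, 1 ≤ l → l ≤ L' → N l ≤ W) ∧
      ∃ (M : ∀ l : ℕ, Matrix (Fin (N (l + 1))) (Fin (N l)) ℝ)
        (b : ∀ l : ℕ, Fin (N (l + 1)) → ℝ),
        ∀ (x : EuclideanSpace ℝ (Fin m)) (i : Fin d),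
          φ x i = (M L').mulVec (nnForward N M b L' (fun j => x (Fin.cast h0 j)))
              (Fin.cast hL.symm i) + b L' (Fin.cast hL.symm i)}

/-- ReLU networks with one-dimensional input, viewed as functions on `ℝ`. -/
def NNset1 (d W L : ℕ) : Set (ℝ → EuclideanSpace ℝ (Fin d)) :=
  {φ | (fun x : EuclideanSpace ℝ (Fin 1) => φ (x 0)) ∈ NNset 1 d W L}

/-! ### Wasserstein distances -/

/-- `WppENN p μ ν` is the `p`-th power of the `p`-th Wasserstein distance, i.e. the optimal
transportation cost `inf_γ ∫ dist(x,y)^p dγ` over all couplings `γ` of `μ` and `ν`. -/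
def WppENN {E : Type*} [MeasurableSpace E] [PseudoEMetricSpace E] (p : ℝ)
    (μ ν : Measure E) : ℝ≥0∞ :=
  ⨅ (γ : Measure (E × E)) (_ : γ.map Prod.fst = μ ∧ γ.map Prod.snd = ν),
    ∫⁻ z, edist z.1 z.2 ^ p ∂γ

/-- The `p`-th Wasserstein distance `W_p(μ,ν)` (valued in `ℝ≥0∞`). -/
def Wdist {E : Type*} [MeasurableSpace E] [PseudoEMetricSpace E] (p : ℝ)
    (μ ν : Measure E) : ℝ≥0∞ :=
  WppENN p μ ν ^ (1 / p)

/-- `𝒫(n)`: the set of discrete probability measures on `ℝ^d` supported on at most `n` points. -/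
def discreteP (d n : ℕ) : Set (Measure (EuclideanSpace ℝ (Fin d))) :=
  {μ | ∃ (x : Fin n → EuclideanSpace ℝ (Fin d)) (w : Fin n → ℝ≥0∞),
    ∑ i, w i = 1 ∧ μ = ∑ i, w i • Measure.dirac (x i)}

/-- The `q`-th absolute moment `M_q^q(μ) = ∫ |x|^q dμ(x)` (valued in `ℝ≥0∞`). -/
def moment (q : ℝ) {d : ℕ} (μ : Measure (EuclideanSpace ℝ (Fin d))) : ℝ≥0∞ :=
  ∫⁻ x, ENNReal.ofReal ‖x‖ ^ q ∂μ

/-- `M_q(μ) = (∫ |x|^q dμ(x))^{1/q}` as a real number (junk value if the moment is infinite). -/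
def Mq (q : ℝ) {d : ℕ} (μ : Measure (EuclideanSpace ℝ (Fin d))) : ℝ :=
  (moment q μ).toReal ^ (1 / q)

/-! ### Covering numbers and dimensions -/

/-- The `ε`-covering number of a set `S`: the smallest number of open balls of radius `ε`
needed to cover `S` (`⊤` if no finite cover exists). -/
def coveringNumber {E : Type*} [PseudoMetricSpace E] (ε : ℝ) (S : Set E) : ℕ∞ :=
  ⨅ (t : Finset E) (_ : S ⊆ ⋃ x ∈ t, Metric.ball x ε), (t.card : ℕ∞)

/-- The `(ε,δ)`-covering number of a measure `μ`:
`inf { N_ε(S) : μ(S) ≥ 1 - δ }`. -/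
def measureCoveringNumber {E : Type*} [PseudoMetricSpace E] [MeasurableSpace E]
    (ε δ : ℝ) (μ : Measure E) : ℕ∞ :=
  ⨅ (S : Set E) (_ : 1 - ENNReal.ofReal δ ≤ μ S), coveringNumber ε S

/-- Base-2 logarithm of an extended natural number, valued in `ℝ≥0∞`. -/
def elog2 (n : ℕ∞) : ℝ≥0∞ :=
  if n = ⊤ then ⊤ else ENNReal.ofReal (Real.logb 2 (n.toNat : ℝ))

/-- The upper dimension `d_r^*(μ) = limsup_{ε → 0} log₂ N_ε(μ, ε^r) / (-log₂ ε)`. -/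
def upperDim {E : Type*} [PseudoMetricSpace E] [MeasurableSpace E] (r : ℝ)
    (μ : Measure E) : ℝ≥0∞ :=
  Filter.limsup
    (fun ε : ℝ => elog2 (measureCoveringNumber ε (ε ^ r) μ) / ENNReal.ofReal (-Real.logb 2 ε))
    (𝓝[>] (0 : ℝ))

/-- The lower dimension `d_*(μ) = lim_{δ → 0} liminf_{ε → 0} log₂ N_ε(μ,δ) / (-log₂ ε)`;
since the inner quantity is antitone in `δ`, the limit as `δ → 0⁺` equals the supremum over
`δ > 0`. -/
def lowerDim {E : Type*} [PseudoMetricSpace E] [MeasurableSpace E] (μ : Measure E) : ℝ≥0∞ :=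
  ⨆ (δ : ℝ) (_ : 0 < δ),
    Filter.liminf
      (fun ε : ℝ => elog2 (measureCoveringNumber ε δ μ) / ENNReal.ofReal (-Real.logb 2 ε))
      (𝓝[>] (0 : ℝ))

/-- The (upper) Minkowski dimension of a set, via covering numbers. -/
def setDimM {E : Type*} [PseudoMetricSpace E] (S : Set E) : ℝ≥0∞ :=
  Filter.limsup
    (fun ε : ℝ => elog2 (coveringNumber ε S) / ENNReal.ofReal (-Real.logb 2 ε))
    (𝓝[>] (0 : ℝ))

/-- The Minkowski dimension of a measure: `inf { dim_M S : μ(S) = 1 }`. -/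
def measureDimM {E : Type*} [PseudoMetricSpace E] [MeasurableSpace E]
    (μ : Measure E) : ℝ≥0∞ :=
  ⨅ (S : Set E) (_ : μ S = 1), setDimM S

/-- The Hausdorff dimension of a measure: `inf { dim_H S : μ(S) = 1 }`. -/
def measureDimH {E : Type*} [EMetricSpace E] [MeasurableSpace E] (μ : Measure E) : ℝ≥0∞ :=
  ⨅ (S : Set E) (_ : μ S = 1), dimH S

/-- The support of a measure on a metric space: points all of whose balls have positive
measure. -/
def msupport {E : Type*} [PseudoMetricSpace E] [MeasurableSpace E] (μ : Measure E) : Set E :=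
  {x | ∀ ε : ℝ, 0 < ε → 0 < μ (Metric.ball x ε)}

/-! ### f-divergences -/

/-- Conversion `EReal → ℝ≥0∞` (negative values go to `0`). -/
def erealToENNReal (x : EReal) : ℝ≥0∞ :=
  if x = ⊤ then ⊤ else ENNReal.ofReal x.toReal

/-- Integral of an `EReal`-valued function: difference of the lower integrals of the positive
and negative parts. -/
def eintegral {α : Type*} [MeasurableSpace α] (μ : Measure α) (g : α → EReal) : EReal :=
  ((∫⁻ x, erealToENNReal (g x) ∂μ : ℝ≥0∞) : EReal)
    - ((∫⁻ x, erealToENNReal (-(g x)) ∂μ : ℝ≥0∞) : EReal)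

/-- `f(0) := lim_{t ↓ 0} f(t)` (as an `EReal`; realized as a `limsup`, which agrees with the
limit whenever the limit exists, e.g. for convex `f`). -/
def limZero (f : ℝ → ℝ) : EReal :=
  Filter.limsup (fun t : ℝ => ((f t : ℝ) : EReal)) (𝓝[>] (0 : ℝ))

/-- `f^*(0) := lim_{t → ∞} f(t)/t` (as an `EReal`; realized as a `limsup`). -/
def limInfty (f : ℝ → ℝ) : EReal :=
  Filter.limsup (fun t : ℝ => ((f t / t : ℝ) : EReal)) Filter.atTop

/-- The `f`-divergence `D_f(μ ‖ ν)`, defined through the reference measure `τ = μ + ν` with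
densities `p = dμ/dτ`, `q = dν/dτ`:
`D_f(μ‖ν) = ∫_{q > 0} f(p/q) q dτ + f^*(0) μ({q = 0})`,
with the conventions `f(0) = lim_{t↓0} f t` on `{p = 0, q > 0}`. -/
def fDiv (f : ℝ → ℝ) {α : Type*} [MeasurableSpace α] (μ ν : Measure α) : EReal :=
  eintegral ((μ + ν).restrict {x | ν.rnDeriv (μ + ν) x ≠ 0})
    (fun x =>
      if μ.rnDeriv (μ + ν) x = 0 then
        limZero f * (((ν.rnDeriv (μ + ν) x).toReal : ℝ) : EReal)
      else
        ((f ((μ.rnDeriv (μ + ν) x / ν.rnDeriv (μ + ν) x).toReal)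
            * (ν.rnDeriv (μ + ν) x).toReal : ℝ) : EReal))
  + limInfty f * ((μ {x | ν.rnDeriv (μ + ν) x = 0} : ℝ≥0∞) : EReal)

/-! ### Piecewise linear functions -/

/-- The space `𝒮^d(z_0, …, z_{N+1})` of continuous piecewise linear functions `ℝ → ℝ^d` with
breakpoints only at `z_0 < … < z_{N+1}`, constant on `(-∞, z_0)` and `(z_{N+1}, ∞)`. -/
def SpaceS (d N : ℕ) (z : Fin (N + 2) → ℝ) : Set (ℝ → EuclideanSpace ℝ (Fin d)) :=
  {φ | Continuous φ ∧
    (∀ x ≤ z 0, φ x = φ (z 0)) ∧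
    (∀ x, z (Fin.last (N + 1)) ≤ x → φ x = φ (z (Fin.last (N + 1)))) ∧
    (∀ i : Fin (N + 1), ∃ a b : EuclideanSpace ℝ (Fin d),
      ∀ x ∈ Set.Icc (z i.castSucc) (z i.succ), φ x = x • a + b)}

/-- A continuous piecewise linear function `ℝ → ℝ^d`. -/
def IsCPwL {d : ℕ} (φ : ℝ → EuclideanSpace ℝ (Fin d)) : Prop :=
  Continuous φ ∧ ∃ (k : ℕ) (z : Fin (k + 1) → ℝ), Monotone z ∧
    (∃ a b : EuclideanSpace ℝ (Fin d), ∀ x ∈ Set.Iic (z 0), φ x = x • a + b) ∧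
    (∀ i : Fin k, ∃ a b : EuclideanSpace ℝ (Fin d),
      ∀ x ∈ Set.Icc (z i.castSucc) (z i.succ), φ x = x • a + b) ∧
    (∃ a b : EuclideanSpace ℝ (Fin d), ∀ x ∈ Set.Ici (z (Fin.last k)), φ x = x • a + b)

end
/-- The covering number of a measure is at most the number of balls in a family of `ε`-balls
whose union has measure at least `1 - δ`. -/
lemma measureCoveringNumber_le_card {E : Type*} [PseudoMetricSpace E] [MeasurableSpace E]
    {ε δ : ℝ} {μ : Measure E} {T : Finset E}
    (h : 1 - ENNReal.ofReal δ ≤ μ (⋃ x ∈ T, Metric.ball x ε)) :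
    measureCoveringNumber ε δ μ ≤ T.card :=
  iInf₂_le_of_le (⋃ x ∈ T, Metric.ball x ε) h (iInf₂_le T Subset.rfl)

lemma elog2_le_of_le_natCast {N : ℕ∞} {n : ℕ} (hn : 1 ≤ n) (h : N ≤ n) :
    elog2 N ≤ ENNReal.ofReal (Real.logb 2 n) := by
  lift N to ℕ using ne_top_of_le_ne_top (ENat.natCast_ne_top n) h
  have hN : N ≤ n := by exact_mod_cast h
  rw [elog2, if_neg (ENat.natCast_ne_top N), ENat.toNat_natCast]
  apply ENNReal.ofReal_le_ofReal
  rcases Nat.eq_zero_or_pos N with rfl | hpos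
  · simpa using Real.logb_nonneg one_lt_two (by exact_mod_cast hn)
  · exact Real.logb_le_logb_of_le one_lt_two (by exact_mod_cast hpos) (by exact_mod_cast hN)

/-- If `t` is strictly below the lower dimension, then for some `δ > 0` and all large `n` the
`(n^{-1/t}, δ)`-covering number is larger than `n`. -/
lemma exists_eventually_lt_measureCoveringNumber {E : Type*} [PseudoMetricSpace E]
    [MeasurableSpace E] {μ : Measure E} {t : ℝ} (ht : 0 < t)
    (htd : ENNReal.ofReal t < lowerDim μ) :
    ∃ δ : ℝ, 0 < δ ∧ ∀ᶠ n : ℕ in atTop,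
      (n : ℕ∞) < measureCoveringNumber ((n : ℝ) ^ (-1 / t)) δ μ := by
  obtain ⟨δ, hδ, hlim⟩ : ∃ δ : ℝ, 0 < δ ∧ ENNReal.ofReal t < Filter.liminf
      (fun ε : ℝ => elog2 (measureCoveringNumber ε δ μ) / ENNReal.ofReal (-Real.logb 2 ε))
      (𝓝[>] (0 : ℝ)) := by
    simpa only [lowerDim, lt_iSup_iff, exists_prop] using htd
  refine ⟨δ, hδ, ?_⟩
  have hev := Filter.eventually_lt_of_lt_liminf hlim
  have hε : Tendsto (fun n : ℕ => (n : ℝ) ^ (-1 / t)) atTop (𝓝[>] 0) := by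
    refine tendsto_nhdsWithin_iff.2 ⟨?_, ?_⟩
    · have := (tendsto_rpow_neg_atTop (y := 1 / t) (by positivity)).comp
        tendsto_natCast_atTop_atTop
      simpa only [Function.comp_def, neg_div] using this
    · filter_upwards [eventually_gt_atTop 0] with n hn
      exact Real.rpow_pos_of_pos (by exact_mod_cast hn) _
  filter_upwards [hε.eventually hev, eventually_ge_atTop 2] with n hn hn2
  by_contra! hle
  have hlog : 0 < Real.logb 2 n := Real.logb_pos one_lt_two (by exact_mod_cast hn2)
  have hlogε : -Real.logb 2 ((n : ℝ) ^ (-1 / t)) = Real.logb 2 n / t := by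
    rw [Real.logb_rpow_eq_mul_logb_of_pos (by positivity)]
    ring
  rw [hlogε] at hn
  refine absurd hn (not_lt.2 ?_)
  calc _ ≤ ENNReal.ofReal (Real.logb 2 n) / ENNReal.ofReal (Real.logb 2 n / t) :=
        ENNReal.div_le_div_right (elog2_le_of_le_natCast (by omega) hle) _
    _ = ENNReal.ofReal t := by
        rw [← ENNReal.ofReal_div_of_pos (by positivity)]
        congr 1
        field_simp

/-- If `ν` is carried by `T` and the `ε`-neighbourhood of `T` misses mass at least `m` of `μ`, then
transporting `μ` to `ν` costs at least `ε ^ p * m`. -/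
lemma rpow_mul_le_WppENN {E : Type*} [MeasurableSpace E] [PseudoMetricSpace E]
    [OpensMeasurableSpace E] [SecondCountableTopology E] {p : ℝ} (hp : 0 ≤ p) {μ ν : Measure E}
    {ε : ℝ} {m : ℝ≥0∞} {T : Finset E} (hν : ∀ᵐ y ∂ν, y ∈ T)
    (hμ : m ≤ μ (⋃ x ∈ T, Metric.ball x ε)ᶜ) :
    ENNReal.ofReal ε ^ p * m ≤ WppENN p μ ν := by
  refine le_iInf₂ fun γ ⟨h₁, h₂⟩ => ?_
  have hU : MeasurableSet (⋃ x ∈ T, Metric.ball x ε)ᶜ :=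
    (Finset.measurableSet_biUnion T fun _ _ => measurableSet_ball).compl
  have hT : ∀ᵐ z ∂γ, z.2 ∈ T := by
    rw [← h₂] at hν
    exact ae_of_ae_map measurable_snd.aemeasurable hν
  have hm : m ≤ γ {z | ENNReal.ofReal ε ^ p ≤ edist z.1 z.2 ^ p} := by
    rw [← h₁, Measure.map_apply measurable_fst hU] at hμ
    refine hμ.trans (measure_mono_ae ?_)
    filter_upwards [hT] with z hz hzU
    refine ENNReal.rpow_le_rpow ?_ hp
    rw [edist_dist]
    refine ENNReal.ofReal_le_ofReal (not_lt.1 fun hlt => hzU ?_)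
    exact mem_biUnion hz hlt
  calc ENNReal.ofReal ε ^ p * m
      ≤ ENNReal.ofReal ε ^ p * γ {z | ENNReal.ofReal ε ^ p ≤ edist z.1 z.2 ^ p} := by gcongr
    _ ≤ ∫⁻ z, edist z.1 z.2 ^ p ∂γ :=
        mul_meas_ge_le_lintegral (measurable_edist.pow_const p) _

lemma exists_finset_of_mem_discreteP {d n : ℕ} {ν : Measure (EuclideanSpace ℝ (Fin d))}
    (hν : ν ∈ discreteP d n) :
    ∃ T : Finset (EuclideanSpace ℝ (Fin d)), T.card ≤ n ∧ ∀ᵐ y ∂ν, y ∈ T := by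
  classical
  obtain ⟨x, w, -, rfl⟩ := hν
  refine ⟨Finset.univ.image x, Finset.card_image_le.trans (by simp), ?_⟩
  have hnull : (∑ i, w i • Measure.dirac (x i)) (↑(Finset.univ.image x) : Set _)ᶜ = 0 := by
    simp [Measure.finsetSum_apply, (Set.finite_range x).measurableSet.compl]
  exact hnull

/-- Theorem, lower bound: approximation by discrete distributions in terms of
the lower dimension. -/
theorem statement11 (p : ℝ) (hp : 1 ≤ p) (d : ℕ)
    (μ : Measure (EuclideanSpace ℝ (Fin d))) [IsProbabilityMeasure μ]
    (t : ℝ) (ht : 0 < t) (htd : ENNReal.ofReal t < lowerDim μ) :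
    ∃ C : ℝ, 0 < C ∧ ∃ n₀ : ℕ, ∀ n ≥ n₀,
      ENNReal.ofReal (C * (n : ℝ) ^ (-1 / t)) ≤ ⨅ γ ∈ discreteP d n, Wdist p μ γ := by
  have hp0 : 0 < p := one_pos.trans_le hp
  obtain ⟨δ, hδ, hev⟩ := exists_eventually_lt_measureCoveringNumber ht htd
  obtain ⟨n₀, hn₀⟩ := eventually_atTop.1 hev
  refine ⟨δ ^ (1 / p), Real.rpow_pos_of_pos hδ _, n₀, fun n hn => le_iInf₂ fun ν hν => ?_⟩
  obtain ⟨T, hTn, hT⟩ := exists_finset_of_mem_discreteP hν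
  set ε : ℝ := (n : ℝ) ^ (-1 / t)
  have hball : μ (⋃ x ∈ T, Metric.ball x ε) < 1 - ENNReal.ofReal δ := by
    by_contra! h
    exact (hn₀ n hn).not_ge ((measureCoveringNumber_le_card h).trans (by exact_mod_cast hTn))
  have hcompl : ENNReal.ofReal δ ≤ μ (⋃ x ∈ T, Metric.ball x ε)ᶜ := by
    rw [prob_compl_eq_one_sub (Finset.measurableSet_biUnion T fun _ _ => measurableSet_ball)]
    refine ENNReal.le_sub_of_add_le_left (measure_ne_top _ _) ?_
    exact (lt_tsub_iff_right.1 hball).le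
  calc ENNReal.ofReal (δ ^ (1 / p) * ε)
      = (ENNReal.ofReal ε ^ p * ENNReal.ofReal δ) ^ (1 / p) := by
        rw [ENNReal.mul_rpow_of_nonneg _ _ (by positivity), one_div,
          ENNReal.rpow_rpow_inv hp0.ne', ENNReal.ofReal_rpow_of_pos hδ, mul_comm,
          ENNReal.ofReal_mul (by positivity)]
    _ ≤ Wdist p μ ν :=
        ENNReal.rpow_le_rpow (rpow_mul_le_WppENN hp0.le hT hcompl) (by positivity)
end

section
/- Let $W \ge 6d$, $q = \lfloor \frac{W}{6d} \rfloor$, and $N = qW$. Then for any breakpoints $z_0 < z_1 < \dots < z_N < z_{N+1}$, every continuous piecewise linear function $f : \mathbb{R} \to \mathbb{R}^d$ with breakpoints only at $z_0, \dots, z_{N+1}$ that vanishes outside $[z_0, z_{N+1}]$ (i.e., every element of $\mathcal{S}_0^d(z_0,\dots,z_{N+1})$) belongs to $\mathcal{NN}(W,2)$. -/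
open MeasureTheory Filter Topology Metric Set
open scoped ENNReal NNReal

/-! ### One-dimensional spline spaces -/

/-- Functions `x ↦ e + ∑_{j < n} c_j (x - ξ_j)₊`, i.e. continuous piecewise linear functions with
breakpoints `ξ_0, …, ξ_{n-1}` that are constant to the left of `ξ_0`. -/
def reluSpline (ξ : ℕ → ℝ) (n : ℕ) : Submodule ℝ (ℝ → ℝ) where
  carrier := {F | ∃ (e : ℝ) (c : ℕ → ℝ), ∀ x, F x = e + ∑ j ∈ Finset.range n, c j * max (x - ξ j) 0}
  zero_mem' := ⟨0, 0, by simp⟩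
  add_mem' := by
    rintro F G ⟨e, c, h⟩ ⟨e', c', h'⟩
    refine ⟨e + e', c + c', fun x => ?_⟩
    simp only [Pi.add_apply, h, h', add_mul, Finset.sum_add_distrib]
    ring
  smul_mem' := by
    rintro r F ⟨e, c, h⟩
    refine ⟨r * e, r • c, fun x => ?_⟩
    simp only [Pi.smul_apply, smul_eq_mul, h, mul_add, Finset.mul_sum, mul_assoc]

lemma max_sub_mem_reluSpline (ξ : ℕ → ℝ) {n j : ℕ} (hj : j < n) :
    (fun x => max (x - ξ j) 0) ∈ reluSpline ξ n :=
  ⟨0, Pi.single j 1, fun x => by simp [Pi.single_apply, hj]⟩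

lemma const_mem_reluSpline (ξ : ℕ → ℝ) (n : ℕ) (e : ℝ) : (fun _ => e) ∈ reluSpline ξ n :=
  ⟨e, 0, by simp⟩

/-- The `j`-th linearity interval of the breakpoints `ξ_0 < … < ξ_{n-1}`; the last one is
unbounded. -/
def knotInterval (ξ : ℕ → ℝ) (n j : ℕ) : Set ℝ := {x | ξ j ≤ x ∧ (j + 1 < n → x ≤ ξ (j + 1))}

/-- `F` coincides on `s` with an affine function. -/
def AffineOn (s : Set ℝ) (F : ℝ → ℝ) : Prop := ∃ a b : ℝ, ∀ x ∈ s, F x = a * x + b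

lemma AffineOn.congr {s : Set ℝ} {F G : ℝ → ℝ} (hF : AffineOn s F) (h : ∀ x ∈ s, G x = F x) :
    AffineOn s G := by
  obtain ⟨a, b, hF⟩ := hF
  exact ⟨a, b, fun x hx => (h x hx).trans (hF x hx)⟩

lemma AffineOn.sub {s : Set ℝ} {F G : ℝ → ℝ} (hF : AffineOn s F) (hG : AffineOn s G) :
    AffineOn s (fun x => F x - G x) := by
  obtain ⟨a, b, hF⟩ := hF
  obtain ⟨a', b', hG⟩ := hG
  exact ⟨a - a', b - b', fun x hx => by simp only [hF x hx, hG x hx]; ring⟩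

lemma AffineOn.sum {ι : Type*} {s : Set ℝ} {t : Finset ι} {F : ι → ℝ → ℝ}
    (hF : ∀ i ∈ t, AffineOn s (F i)) : AffineOn s (fun x => ∑ i ∈ t, F i x) := by
  classical
  induction t using Finset.induction_on with
  | empty => exact ⟨0, 0, by simp⟩
  | insert i t hi ih =>
    obtain ⟨a, b, h⟩ := hF i (Finset.mem_insert_self i t)
    obtain ⟨a', b', h'⟩ := ih fun k hk => hF k (Finset.mem_insert_of_mem hk)
    refine ⟨a + a', b + b', fun x hx => ?_⟩
    beta_reduce at h' ⊢
    rw [Finset.sum_insert hi, h x hx, h' x hx]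
    ring

lemma exists_mem_knotInterval (ξ : ℕ → ℝ) (n : ℕ) {x : ℝ} (hx : ξ 0 ≤ x) :
    ∃ j < n + 1, x ∈ knotInterval ξ (n + 1) j := by
  induction n with
  | zero => exact ⟨0, by simp, hx, fun h => by omega⟩
  | succ n ih =>
    obtain ⟨j, hj, hjx, hx'⟩ := ih
    by_cases h : j + 1 < n + 1
    · exact ⟨j, by omega, hjx, fun _ => hx' h⟩
    · obtain rfl : j = n := by omega
      rcases le_total x (ξ (j + 1)) with h1 | h1
      · exact ⟨j, by omega, hjx, fun _ => h1⟩
      · exact ⟨j + 1, by omega, h1, fun h => by omega⟩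

/-- Compatible affine pieces glue to a spline. -/
lemma exists_mem_reluSpline_glue {ξ : ℕ → ℝ} (hξ : StrictMono ξ) (n : ℕ) (v m : ℕ → ℝ)
    (hv : ∀ j, j + 1 < n + 1 → v (j + 1) = v j + m j * (ξ (j + 1) - ξ j)) :
    ∃ g ∈ reluSpline ξ (n + 1), (∀ x ≤ ξ 0, g x = v 0) ∧
      ∀ j < n + 1, ∀ x ∈ knotInterval ξ (n + 1) j, g x = v j + m j * (x - ξ j) := by
  induction n with
  | zero =>
    refine ⟨_, ⟨v 0, m, fun x => rfl⟩, fun x hx => ?_, fun j hj x hx => ?_⟩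
    · simp [hx]
    · obtain rfl : j = 0 := by omega
      simp [hx.1]
  | succ n ih =>
    obtain ⟨g, ⟨e, c, hg⟩, hg0, hgj⟩ := ih fun j hj => hv j (by omega)
    have hmem : g ∈ reluSpline ξ (n + 1 + 1) := by
      refine ⟨e, fun j => if j < n + 1 then c j else 0, fun x => ?_⟩
      rw [Finset.sum_range_succ, hg]
      simp only [lt_irrefl, if_false, zero_mul, add_zero]
      congr 1
      refine Finset.sum_congr rfl fun j hj => ?_
      rw [if_pos (Finset.mem_range.1 hj)]
    refine ⟨g + (m (n + 1) - m n) • (fun x => max (x - ξ (n + 1)) 0),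
      add_mem hmem (Submodule.smul_mem _ _ (max_sub_mem_reluSpline ξ (by omega))),
      fun x hx => ?_, fun j hj x hx => ?_⟩
    · have : x ≤ ξ (n + 1) := hx.trans (hξ.monotone (Nat.zero_le _))
      simp [hg0 x hx, this]
    · rcases Nat.lt_succ_iff_lt_or_eq.1 hj with h | rfl
      · have h1 : x ≤ ξ (n + 1) := (hx.2 (by omega)).trans (hξ.monotone (by omega))
        rw [Pi.add_apply, hgj j h x ⟨hx.1, fun _ => hx.2 (by omega)⟩]
        simp [h1]
      · have h1 : ξ (n + 1) ≤ x := hx.1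
        rw [Pi.add_apply, hgj n (by omega) x
          ⟨(hξ.monotone (Nat.le_succ n)).trans h1, fun h => by omega⟩, hv n (by omega)]
        simp only [Pi.smul_apply, smul_eq_mul, max_eq_left (sub_nonneg.2 h1)]
        ring

lemma mem_reluSpline_of_affineOn {ξ : ℕ → ℝ} (hξ : StrictMono ξ) {n : ℕ} (hn : 0 < n) {F : ℝ → ℝ}
    (h0 : ∀ x ≤ ξ 0, F x = F (ξ 0)) (hF : ∀ j < n, AffineOn (knotInterval ξ n j) F) :
    F ∈ reluSpline ξ n := by
  obtain ⟨n, rfl⟩ : ∃ k, n = k + 1 := ⟨n - 1, by omega⟩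
  have hF' : ∀ j, ∃ m, j < n + 1 → ∀ x ∈ knotInterval ξ (n + 1) j,
      F x = F (ξ j) + m * (x - ξ j) := by
    intro j
    by_cases hj : j < n + 1
    · obtain ⟨a, b, h⟩ := hF j hj
      refine ⟨a, fun _ x hx => ?_⟩
      rw [h x hx, h (ξ j) ⟨le_rfl, fun _ => (hξ (Nat.lt_succ_self j)).le⟩]
      ring
    · exact ⟨0, fun h => absurd h hj⟩
  choose m hm using hF'
  obtain ⟨g, hg, hg0, hgj⟩ := exists_mem_reluSpline_glue hξ n (fun j => F (ξ j)) m
    fun j hj => hm j (by omega) _ ⟨(hξ (Nat.lt_succ_self j)).le, fun _ => le_rfl⟩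
  have : F = g := by
    ext x
    rcases le_total x (ξ 0) with hx | hx
    · rw [h0 x hx, hg0 x hx]
    · obtain ⟨j, hj, hjx⟩ := exists_mem_knotInterval ξ n hx
      rw [hm j hj x hjx, hgj j hj x hjx]
  rwa [this]

/-- Nonnegative kinks at one point of every second linearity interval of a spline space are
produced, up to the spline space, by the positive part of a single zigzagging spline. -/
lemma exists_max_sub_sum_mem_reluSpline {ξ a w : ℕ → ℝ} (hξ : StrictMono ξ)
    (ha : ∀ j, ξ j < a j) (ha' : ∀ j, a j < ξ (j + 1)) (hw : ∀ j, 0 ≤ w j) {n : ℕ} (hn : 0 < n)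
    (p : ℕ) (hp : ∀ j, j % 2 ≠ p → w j = 0) :
    ∃ g ∈ reluSpline ξ n, (fun x => max (g x) 0 -
      ∑ j ∈ Finset.range n, w j * max (x - a j) 0) ∈ reluSpline ξ n := by
  obtain ⟨n, rfl⟩ : ∃ k, n = k + 1 := ⟨n - 1, by omega⟩
  set A : ℕ → ℝ := fun j => (-1) ^ (j / 2) * w j with hA
  set v : ℕ → ℝ := fun j => if j % 2 = p then A j * (ξ j - a j) else
    if j = 0 then 0 else A (j - 1) * (ξ j - a (j - 1)) with hv
  set m : ℕ → ℝ := fun j => if j % 2 = p then A j else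
    if j + 1 < n + 1 then (v (j + 1) - v j) / (ξ (j + 1) - ξ j) else 0 with hm
  have hpos : ∀ j, 0 < ξ (j + 1) - ξ j := fun j => sub_pos.2 (hξ (Nat.lt_succ_self j))
  obtain ⟨g, hg, hg0, hgj⟩ := exists_mem_reluSpline_glue hξ n v m <| by
    intro j hj
    by_cases h : j % 2 = p
    · have h' : (j + 1) % 2 ≠ p := by omega
      simp only [hv, hm, h, h', if_true, if_false, Nat.succ_ne_zero, Nat.add_sub_cancel]
      ring
    · have : m j = (v (j + 1) - v j) / (ξ (j + 1) - ξ j) := by simp only [hm, h, hj, if_true, if_false]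
      rw [this, div_mul_cancel₀ _ (hpos j).ne']
      ring
  refine ⟨g, hg, mem_reluSpline_of_affineOn hξ (by omega) (fun x hx => ?_) fun j hj => ?_⟩
  · rw [hg0 x hx, hg0 _ le_rfl]
    congr 1
    refine Finset.sum_congr rfl fun j _ => ?_
    have h := (hξ.monotone (Nat.zero_le j)).trans (ha j).le
    rw [max_eq_right (sub_nonpos.2 (hx.trans h)), max_eq_right (sub_nonpos.2 h)]
  have hrest : AffineOn (knotInterval ξ (n + 1) j)
      (fun x => ∑ i ∈ (Finset.range (n + 1)).erase j, w i * max (x - a i) 0) := by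
    refine AffineOn.sum fun i hi => ?_
    rw [Finset.mem_erase, Finset.mem_range] at hi
    rcases lt_or_gt_of_ne hi.1 with h | h
    · refine ⟨w i, -(w i * a i), fun x hx => ?_⟩
      have : a i ≤ x := (ha' i).le.trans ((hξ.monotone h).trans hx.1)
      beta_reduce
      rw [max_eq_left (sub_nonneg.2 this)]
      ring
    · refine ⟨0, 0, fun x hx => ?_⟩
      have : x ≤ a i := (hx.2 (by omega)).trans ((hξ.monotone h).trans (ha i).le)
      beta_reduce
      rw [max_eq_right (sub_nonpos.2 this)]
      ring
  have hmain : AffineOn (knotInterval ξ (n + 1) j)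
      (fun x => max (g x) 0 - w j * max (x - a j) 0) := by
    by_cases h : j % 2 = p
    · have hg' : ∀ x ∈ knotInterval ξ (n + 1) j, g x = A j * (x - a j) := by
        intro x hx
        rw [hgj j hj x hx]
        simp only [hv, hm, h, if_true]
        ring
      rcases neg_one_pow_eq_or ℝ (j / 2) with hs | hs
      · refine ⟨0, 0, fun x hx => ?_⟩
        beta_reduce
        rw [hg' x hx, hA]
        simp only [hs, one_mul]
        rw [mul_max_of_nonneg _ _ (hw j)]
        simp
      · refine ⟨-w j, w j * a j, fun x hx => ?_⟩
        beta_reduce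
        rw [hg' x hx, hA]
        simp only [hs]
        rcases le_total x (a j) with hx | hx
        · rw [max_eq_left, max_eq_right (sub_nonpos.2 hx)]
          · ring
          · nlinarith [hw j]
        · rw [max_eq_right, max_eq_left (sub_nonneg.2 hx)]
          · ring
          · nlinarith [hw j]
    · rw [hp j h]
      simp only [zero_mul, sub_zero]
      obtain ⟨s, hs, hvj, hvj'⟩ : ∃ s : ℝ, (s = 1 ∨ s = -1) ∧ 0 ≤ s * v j ∧
          (j + 1 < n + 1 → 0 ≤ s * v (j + 1)) := by
        have hsq : ∀ k : ℕ, ((-1 : ℝ) ^ k) * (-1) ^ k = 1 := fun k => by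
          rw [← mul_pow]
          norm_num
        refine ⟨-(-1) ^ ((j + 1) / 2), ?_, ?_, fun _ => ?_⟩
        · rcases neg_one_pow_eq_or ℝ ((j + 1) / 2) with hs | hs <;> simp [hs]
        · by_cases h0 : j = 0
          · simp only [hv, if_neg h, if_pos h0, mul_zero, le_refl]
          · obtain ⟨k, rfl⟩ := Nat.exists_eq_succ_of_ne_zero h0
            have hk : (k.succ + 1) / 2 = k / 2 + 1 := by omega
            simp only [hv, hA, h, h0, if_false, Nat.succ_sub_one, hk]
            have : -(-1 : ℝ) ^ (k / 2 + 1) * ((-1) ^ (k / 2) * w k * (ξ k.succ - a k)) =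
                ((-1) ^ (k / 2) * (-1) ^ (k / 2)) * (w k * (ξ k.succ - a k)) := by ring
            rw [this, hsq, one_mul]
            exact mul_nonneg (hw k) (sub_nonneg.2 (ha' k).le)
        · by_cases h1 : (j + 1) % 2 = p
          · simp only [hv, hA, h1, if_true]
            have : -(-1 : ℝ) ^ ((j + 1) / 2) *
                ((-1) ^ ((j + 1) / 2) * w (j + 1) * (ξ (j + 1) - a (j + 1))) =
                ((-1) ^ ((j + 1) / 2) * (-1) ^ ((j + 1) / 2)) *
                  (w (j + 1) * (a (j + 1) - ξ (j + 1))) := by ring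
            rw [this, hsq, one_mul]
            exact mul_nonneg (hw _) (sub_nonneg.2 (ha _).le)
          · have hw0 : w j = 0 := hp j h
            simp [hv, hA, h1, hw0]
      have hsg : ∀ x ∈ knotInterval ξ (n + 1) j, 0 ≤ s * g x := by
        intro x hx
        rw [hgj j hj x hx]
        by_cases h' : j + 1 < n + 1
        · have : m j = (v (j + 1) - v j) / (ξ (j + 1) - ξ j) := by
            simp only [hm, h, h', if_true, if_false]
          have h1 := hx.1
          have h2 := hx.2 h'
          have e : s * (v j + m j * (x - ξ j)) = (s * v j * (ξ (j + 1) - x) +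
              s * v (j + 1) * (x - ξ j)) / (ξ (j + 1) - ξ j) := by
            rw [this]
            field_simp [(hpos j).ne']
            ring
          rw [e]
          exact div_nonneg (add_nonneg (mul_nonneg hvj (sub_nonneg.2 h2))
            (mul_nonneg (hvj' h') (sub_nonneg.2 h1))) (hpos j).le
        · have : m j = 0 := by simp only [hm, h, h', if_false]
          simpa [this] using hvj
      rcases hs with rfl | rfl
      · refine ⟨m j, v j - m j * ξ j, fun x hx => ?_⟩
        beta_reduce
        rw [max_eq_left (by linarith [hsg x hx]), hgj j hj x hx]
        ring
      · refine ⟨0, 0, fun x hx => ?_⟩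
        beta_reduce
        rw [max_eq_right (by linarith [hsg x hx])]
        ring
  refine (hmain.sub hrest).congr fun x _ => ?_
  rw [← Finset.add_sum_erase _ _ (Finset.mem_range.2 hj)]
  ring

/-- Arbitrary kinks, one in each linearity interval, cost four positive parts of splines: one for
each parity of the interval and each sign of the kink. -/
lemma exists_sum_sub_sum_mem_reluSpline {ξ a : ℕ → ℝ} (hξ : StrictMono ξ)
    (ha : ∀ j, ξ j < a j) (ha' : ∀ j, a j < ξ (j + 1)) {n : ℕ} (hn : 0 < n) (κ : ℕ → ℝ) :
    ∃ g : Fin 2 × Bool → ℝ → ℝ, (∀ ν, g ν ∈ reluSpline ξ n) ∧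
      (fun x => ∑ j ∈ Finset.range n, κ j * max (x - a j) 0 -
        ∑ ν, (if ν.2 then 1 else -1) * max (g ν x) 0) ∈ reluSpline ξ n := by
  set w : Fin 2 × Bool → ℕ → ℝ := fun ν j =>
    if j % 2 = ν.1 then max ((if ν.2 then 1 else -1) * κ j) 0 else 0 with hw
  have H : ∀ ν, ∃ g ∈ reluSpline ξ n, (fun x => max (g x) 0 -
      ∑ j ∈ Finset.range n, w ν j * max (x - a j) 0) ∈ reluSpline ξ n := fun ν => by
    refine exists_max_sub_sum_mem_reluSpline hξ ha ha' (fun j => ?_) hn ν.1 fun j hj => ?_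
    · simp only [hw]
      split_ifs <;> simp
    · simp [hw, hj]
  choose g hg hg' using H
  refine ⟨g, hg, ?_⟩
  have hmem := Submodule.sum_mem (reluSpline ξ n) (t := Finset.univ)
    fun ν _ => Submodule.smul_mem _ (if ν.2 then (-1 : ℝ) else 1) (hg' ν)
  convert hmem using 1
  ext x
  have hκ : ∀ j, κ j = ∑ ν, (if ν.2 then (1 : ℝ) else -1) * w ν j := by
    intro j
    simp only [hw, Fintype.sum_prod_type, Fin.sum_univ_two, Fintype.sum_bool]
    have : κ j = max (κ j) 0 - max (-κ j) 0 := by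
      rcases le_total (κ j) 0 with h | h <;> simp [h]
    rcases Nat.mod_two_eq_zero_or_one j with h | h <;> simp [h] <;> linarith
  simp only [Finset.sum_apply, Pi.smul_apply, smul_eq_mul, mul_sub, Finset.sum_sub_distrib]
  have e : ∑ j ∈ Finset.range n, κ j * max (x - a j) 0 =
      ∑ ν, (if ν.2 then (1 : ℝ) else -1) * ∑ j ∈ Finset.range n, w ν j * max (x - a j) 0 := by
    simp only [Finset.mul_sum]
    rw [Finset.sum_comm]
    refine Finset.sum_congr rfl fun j _ => ?_
    rw [hκ j, Finset.sum_mul]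
    exact Finset.sum_congr rfl fun ν _ => by ring
  have hneg : ∀ ν : Fin 2 × Bool, (if ν.2 then (-1 : ℝ) else 1) = -(if ν.2 then (1 : ℝ) else -1) := by
    intro ν
    split_ifs <;> simp
  simp only [e, hneg, neg_mul, Finset.sum_neg_distrib]
  ring

/-- A spline with `n (q + 1)` breakpoints is a signed sum of `4 q + 2` positive parts of splines
with `n` breakpoints. -/
lemma exists_eq_sum_max_of_mem_reluSpline {Z : ℕ → ℝ} (hZ : StrictMono Z) {n : ℕ} (hn : 0 < n)
    (q : ℕ) {F : ℝ → ℝ} (hF : F ∈ reluSpline Z (n * (q + 1))) :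
    ∃ (g : Fin q × (Fin 2 × Bool) ⊕ Bool → ℝ → ℝ) (ε : Fin q × (Fin 2 × Bool) ⊕ Bool → ℝ),
      (∀ ν, g ν ∈ reluSpline (fun j => Z (j * (q + 1))) n) ∧
        ∀ x, F x = ∑ ν, ε ν * max (g ν x) 0 := by
  obtain ⟨e, c, hF⟩ := hF
  set ξ : ℕ → ℝ := fun j => Z (j * (q + 1)) with hξ_def
  have hξ : StrictMono ξ := fun i j h => hZ (Nat.mul_lt_mul_of_pos_right h (Nat.succ_pos q))
  have H := fun i : Fin q => exists_sum_sub_sum_mem_reluSpline (a := fun j => Z (j * (q + 1) + (i + 1)))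
    hξ (fun j => hZ (by omega))
    (fun j => hZ (by rw [add_mul, one_mul]; have := i.2; omega)) hn fun j => c (j * (q + 1) + (i + 1))
  choose g hg hg' using H
  set r : ℝ → ℝ := fun x => F x -
    ∑ ν : Fin q × (Fin 2 × Bool), (if ν.2.2 then 1 else -1) * max (g ν.1 ν.2 x) 0 with hr_def
  have hr : r ∈ reluSpline ξ n := by
    have h1 := Submodule.sum_mem (reluSpline ξ n) (t := Finset.univ) fun i _ => hg' i
    have h2 : (fun x => e + ∑ j ∈ Finset.range n, c (j * (q + 1)) * max (x - ξ j) 0) ∈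
        reluSpline ξ n := ⟨e, fun j => c (j * (q + 1)), fun x => rfl⟩
    convert add_mem h2 h1 using 1
    ext x
    have hsum : ∀ f : ℕ → ℝ, ∑ k ∈ Finset.range (n * (q + 1)), f k =
        ∑ j ∈ Finset.range n, f (j * (q + 1)) +
          ∑ i : Fin q, ∑ j ∈ Finset.range n, f (j * (q + 1) + (i + 1)) := by
      intro f
      rw [Finset.sum_comm, ← Finset.sum_add_distrib]
      clear hF hg hg' h1 h2 hn
      induction n with
      | zero => simp
      | succ n ih =>
        rw [add_mul, one_mul, Finset.sum_range_add, ih, Finset.sum_range_succ _ n,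
          Finset.sum_range_succ' _ q, Finset.sum_range fun i => f (n * (q + 1) + (i + 1)), add_zero]
        ring
    simp only [hr_def, hF, hsum, Pi.add_apply, Finset.sum_apply, Fintype.sum_prod_type,
      Finset.sum_sub_distrib]
    ring
  refine ⟨Sum.elim (fun ν => g ν.1 ν.2) (fun s => if s then r else -r),
    Sum.elim (fun ν => if ν.2.2 then 1 else -1) (fun s => if s then 1 else -1), ?_, fun x => ?_⟩
  · rintro (ν | _ | _)
    · exact hg _ _
    · simpa using hr
    · simpa using hr
  · have : r x = max (r x) 0 - max (-r x) 0 := by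
      rcases le_total (r x) 0 with h | h <;> simp [h]
    rw [Fintype.sum_sum_type]
    simp only [Sum.elim_inl, Sum.elim_inr, Fintype.sum_bool]
    simp only [if_true, Bool.false_eq_true, if_false, Pi.neg_apply]
    have h' : F x = r x + ∑ ν : Fin q × (Fin 2 × Bool),
      (if ν.2.2 then 1 else -1) * max (g ν.1 ν.2 x) 0 := by simp [hr_def]
    linarith

/-- Linear combinations of positive parts of splines are networks with two hidden layers. -/
lemma mem_NNset_of_eq_sum_max {d W : ℕ} {ι : Type*} [Fintype ι] (hι : Fintype.card ι ≤ W)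
    {ξ : ℕ → ℝ} {φ : ℝ → EuclideanSpace ℝ (Fin d)} (g : ι → ℝ → ℝ)
    (hg : ∀ ν, g ν ∈ reluSpline ξ W) (ε : Fin d → ι → ℝ)
    (hφ : ∀ x t, φ x t = ∑ ν, ε t ν * max (g ν x) 0) :
    (fun x : EuclideanSpace ℝ (Fin 1) => φ (x 0)) ∈ NNset 1 d W 2 := by
  choose e c hg using hg
  let u := (Fintype.equivFin ι).symm
  let N : ℕ → ℕ := fun l => match l with
    | 0 => 1
    | 1 => W
    | 2 => Fintype.card ι
    | _ => d
  let M : ∀ l : ℕ, Matrix (Fin (N (l + 1))) (Fin (N l)) ℝ := fun l => match l with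
    | 0 => fun _ _ => 1
    | 1 => fun i j => c (u i) j
    | 2 => fun t i => ε t (u i)
    | _ + 3 => 0
  let b : ∀ l : ℕ, Fin (N (l + 1)) → ℝ := fun l => match l with
    | 0 => fun j => -ξ j
    | 1 => fun i => e (u i)
    | _ + 2 => 0
  refine ⟨2, by norm_num, le_rfl, N, rfl, rfl, fun l h1 h2 => ?_, M, b, fun x t => ?_⟩
  · interval_cases l
    · exact le_rfl
    · exact hι
  have h1 : ∀ j : Fin W, nnForward N M b 1 (fun j => x (Fin.cast rfl j)) j = max (x 0 - ξ j) 0 := by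
    intro j
    change max (∑ i : Fin 1, (1 : ℝ) * x i + -ξ j) 0 = _
    simp [sub_eq_add_neg]
  have h2 : ∀ i : Fin (Fintype.card ι), nnForward N M b 2 (fun j => x (Fin.cast rfl j)) i =
      max (g (u i) (x 0)) 0 := by
    intro i
    change max (∑ j : Fin W, c (u i) j * nnForward N M b 1 (fun j => x (Fin.cast rfl j)) j +
      e (u i)) 0 = _
    simp only [h1, hg]
    rw [add_comm, Finset.sum_range]
  change φ (x 0) t = ∑ i : Fin (Fintype.card ι),
    ε t (u i) * nnForward N M b 2 (fun j => x (Fin.cast rfl j)) i + 0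
  simp only [h2]
  rw [add_zero, hφ]
  exact (Equiv.sum_comp u fun ν => ε t ν * max (g ν (x 0)) 0).symm

/-- Lemma: piecewise linear functions vanishing outside `[z_0, z_{N+1}]` with
`N = qW`, `q = ⌊W/(6d)⌋`, are representable by ReLU networks of width `W` and depth `2`. -/
theorem statement12 (d W N : ℕ) (hd : 0 < d) (hW : 6 * d ≤ W)
    (hN : N = W / (6 * d) * W)
    (z : Fin (N + 2) → ℝ) (hz : StrictMono z) :
    ∀ φ ∈ SpaceS d N z, φ (z 0) = 0 → φ (z (Fin.last (N + 1))) = 0 →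
      (fun x : EuclideanSpace ℝ (Fin 1) => φ (x 0)) ∈ NNset 1 d W 2 := by
  rintro φ ⟨-, hleft, hright, hpiece⟩ - -
  set q := W / (6 * d) with hq_def
  have hq : 0 < q := Nat.div_pos hW (by omega)
  have hqW : q * (6 * d) ≤ W := Nat.div_mul_le_self W (6 * d)
  have hW0 : 0 < W := by omega
  have hNW : N + 2 ≤ W * (q + 1) := by
    rw [hN]
    nlinarith
  set Z : ℕ → ℝ := fun k => if h : k < N + 2 then z ⟨k, h⟩ else z (Fin.last (N + 1)) + k with hZ_def
  have hZz : ∀ k (h : k < N + 2), Z k = z ⟨k, h⟩ := fun k h => by simp [hZ_def, h]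
  have hZ : StrictMono Z := by
    refine strictMono_nat_of_lt_succ fun k => ?_
    by_cases h : k + 1 < N + 2
    · rw [hZz k (by omega), hZz (k + 1) h]
      exact hz (Fin.mk_lt_mk.2 (Nat.lt_succ_self k))
    · by_cases h' : k < N + 2
      · obtain rfl : k = N + 1 := by omega
        have : (⟨N + 1, h'⟩ : Fin (N + 2)) = Fin.last (N + 1) := rfl
        simp only [hZ_def, h, h', dif_pos, dif_neg, not_false_eq_true, this]
        push_cast
        linarith [(Nat.cast_nonneg N : (0 : ℝ) ≤ N)]
      · simp only [hZ_def, h, h', dif_neg, not_false_eq_true]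
        push_cast
        linarith
  have hZ0 : Z 0 = z 0 := hZz 0 (by omega)
  have hmem : ∀ t, (fun x => φ x t) ∈ reluSpline Z (W * (q + 1)) := by
    intro t
    refine mem_reluSpline_of_affineOn hZ (by omega) (fun x hx => ?_) fun k hk => ?_
    · rw [hZ0] at hx ⊢
      rw [hleft x hx]
    · by_cases h : k < N + 1
      · obtain ⟨a, b, hab⟩ := hpiece ⟨k, h⟩
        refine ⟨a t, b t, fun x hx => ?_⟩
        have h1 := hx.1
        have h2 := hx.2 (by omega)
        rw [hZz k (by omega)] at h1
        rw [hZz (k + 1) (by omega)] at h2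
        simp only [hab x ⟨h1, h2⟩, PiLp.add_apply, PiLp.smul_apply, smul_eq_mul]
        ring
      · refine ⟨0, φ (z (Fin.last (N + 1))) t, fun x hx => ?_⟩
        have : z (Fin.last (N + 1)) ≤ x := by
          have h1 := (hZ.monotone (show N + 1 ≤ k by omega)).trans hx.1
          rwa [hZz (N + 1) (by omega)] at h1
        beta_reduce
        rw [hright x this]
        ring
  choose g ε hg hφ using fun t => exists_eq_sum_max_of_mem_reluSpline hZ hW0 q (hmem t)
  refine mem_NNset_of_eq_sum_max (ι := Fin d × (Fin q × (Fin 2 × Bool) ⊕ Bool)) ?_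
    (fun ν => g ν.1 ν.2) (fun ν => hg ν.1 ν.2) (fun t ν => if ν.1 = t then ε t ν.2 else 0) ?_
  · simp only [Fintype.card_prod, Fintype.card_sum, Fintype.card_fin, Fintype.card_bool]
    nlinarith
  · intro x t
    rw [hφ t x, Fintype.sum_prod_type, Finset.sum_eq_single t]
    · simp
    · intro t' _ ht'
      simp [ht']
    · simp
end

section
/- Suppose $W \ge 6d$, $L \ge 1$ and $N \le W \lfloor \frac{W}{6d} \rfloor L$. Then for any real numbers $z_0 < z_1 < \dots < z_N < z_{N+1}$, one has $\mathcal{S}^d(z_0,\dots,z_{N+1}) \subseteq \mathcal{NN}(W+d+1, 2L)$. -/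
open MeasureTheory Filter Topology Metric Set
open scoped ENNReal NNReal

/-! ### Layers as spaces of functions -/

/-- The functions in `V'` are affine combinations of `K` neurons whose pre-activations lie
in `V`. -/
def ReluStep (K : ℕ) (V V' : Submodule ℝ (ℝ → ℝ)) : Prop :=
  ∃ S : Fin K → ℝ → ℝ, (∀ k, ∃ v ∈ V, ∀ x, S k x = max (v x) 0) ∧
    V' ≤ Submodule.span ℝ (insert 1 (Set.range S))

theorem ReluStep.of_fintype {K : ℕ} {V V' : Submodule ℝ (ℝ → ℝ)} {ι : Type*} [Fintype ι]
    (hc : Fintype.card ι ≤ K) (S : ι → ℝ → ℝ) (hS : ∀ k, ∃ v ∈ V, ∀ x, S k x = max (v x) 0)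
    (hV : V' ≤ Submodule.span ℝ (insert 1 (Set.range S))) : ReluStep K V V' := by
  obtain ⟨e⟩ : Nonempty (ι ↪ Fin K) := Function.Embedding.nonempty_of_card_le (by simpa using hc)
  refine ⟨Function.extend e S 0, fun k => ?_, hV.trans (Submodule.span_mono ?_)⟩
  · by_cases h : ∃ i, e i = k
    · obtain ⟨i, rfl⟩ := h
      rw [e.injective.extend_apply]
      exact hS i
    · rw [Function.extend_apply' _ _ _ h]
      exact ⟨0, V.zero_mem, fun x => by simp⟩
  · refine Set.insert_subset_insert ?_
    rintro _ ⟨i, rfl⟩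
    exact ⟨e i, e.injective.extend_apply _ _ _⟩

theorem exists_affine_of_mem_span {κ : Type*} [Fintype κ] {g : κ → ℝ → ℝ} {v : ℝ → ℝ}
    (hv : v ∈ Submodule.span ℝ (insert 1 (Set.range g))) :
    ∃ (w : κ → ℝ) (β : ℝ), ∀ x, v x = ∑ j, w j * g j x + β := by
  obtain ⟨β, u, hu, rfl⟩ := Submodule.mem_span_insert.1 hv
  obtain ⟨w, rfl⟩ := (Submodule.mem_span_range_iff_exists_fun ℝ).1 hu
  exact ⟨w, β, fun x => by simp [Finset.sum_apply, add_comm]⟩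

/-- Layer widths of a network with `n` hidden layers of width `K`. -/
def layerWidth (d K n l : ℕ) : ℕ := if l = 0 then 1 else if l = n + 1 then d else K

theorem mem_NNset_of_reluStep {d K n : ℕ} (hn : 1 ≤ n) (V : ℕ → Submodule ℝ (ℝ → ℝ))
    (hV0 : V 0 ≤ Submodule.span ℝ {1, id}) (hV : ∀ l, ReluStep K (V l) (V (l + 1)))
    (φ : ℝ → EuclideanSpace ℝ (Fin d)) (hφ : ∀ i, (fun x => φ x i) ∈ V n) :
    (fun x : EuclideanSpace ℝ (Fin 1) => φ (x 0)) ∈ NNset 1 d K n := by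
  choose S hS hVS using hV
  set N := layerWidth d K n with hNdef
  have h0 : N 0 = 1 := by simp [hNdef, layerWidth]
  have hN1 : ∀ l, 1 ≤ l → l ≤ n → N l = K := by
    intro l h1 h2
    rw [hNdef, layerWidth, if_neg (by omega), if_neg (by omega)]
  have hNL : N (n + 1) = d := by simp [hNdef, layerWidth]
  let G : ∀ l, Fin (N l) → ℝ → ℝ := fun l j x =>
    if l = 0 then x else if h : (j : ℕ) < K then S (l - 1) ⟨j, h⟩ x else 0
  have hG : ∀ l, l ≤ n → V l ≤ Submodule.span ℝ (insert 1 (Set.range (G l))) := by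
    intro l hl
    rcases l with _ | l
    · refine hV0.trans (Submodule.span_mono (Set.insert_subset_insert ?_))
      rintro _ rfl
      exact ⟨⟨0, by omega⟩, by ext x; simp [G]⟩
    · refine (hVS l).trans (Submodule.span_mono (Set.insert_subset_insert ?_))
      rintro _ ⟨k, rfl⟩
      have := hN1 (l + 1) (by omega) hl
      exact ⟨⟨k, by omega⟩, by ext x; simp [G]⟩
  have key : ∀ l, ∃ (M : Matrix (Fin (N (l + 1))) (Fin (N l)) ℝ) (b : Fin (N (l + 1)) → ℝ),
      (l < n → ∀ i x, G (l + 1) i x = max (∑ j, M i j * G l j x + b i) 0) ∧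
      (∀ h : l = n, ∀ i x, φ x (Fin.cast (by rw [h, hNL]) i) = ∑ j, M i j * G l j x + b i) := by
    intro l
    rcases lt_trichotomy l n with h | h | h
    · have hrow : ∀ i : Fin (N (l + 1)), ∃ (w : Fin (N l) → ℝ) (β : ℝ),
          ∀ x, G (l + 1) i x = max (∑ j, w j * G l j x + β) 0 := by
        intro i
        have hi : (i : ℕ) < K := by
          have := hN1 (l + 1) (by omega) h
          omega
        obtain ⟨v, hv, hvS⟩ := hS l ⟨i, hi⟩
        obtain ⟨w, β, hw⟩ := exists_affine_of_mem_span (hG l h.le hv)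
        exact ⟨w, β, fun x => by rw [← hw, ← hvS]; simp [G, hi]⟩
      choose w β hw using hrow
      exact ⟨w, β, fun _ => hw, fun h' => absurd h' h.ne⟩
    · subst h
      have hrow : ∀ i : Fin (N (l + 1)), ∃ (w : Fin (N l) → ℝ) (β : ℝ),
          ∀ x, φ x (Fin.cast hNL i) = ∑ j, w j * G l j x + β := fun i =>
        exists_affine_of_mem_span (hG l le_rfl (hφ (Fin.cast hNL i)))
      choose w β hw using hrow
      exact ⟨w, β, fun h' => absurd h' (lt_irrefl _), fun _ => hw⟩
    · exact ⟨0, 0, fun h' => absurd h' h.not_gt, fun h' => absurd h' h.ne'⟩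
  choose M b hM hMn using key
  refine ⟨n, hn, le_rfl, N, h0, hNL, fun l h1 h2 => (hN1 l h1 h2).le, M, b, fun x i => ?_⟩
  have hfwd : ∀ l, l ≤ n → ∀ j,
      nnForward N M b l (fun j => x (Fin.cast h0 j)) j = G l j (x 0) := by
    intro l
    induction l with
    | zero =>
      intro _ j
      simp only [nnForward, G, if_true]
      exact congrArg x (Subsingleton.elim _ _)
    | succ l ih =>
      intro hl j
      rw [hM l (by omega) j (x 0)]
      simp only [nnForward, Matrix.mulVec, dotProduct]
      congr 2
      exact Finset.sum_congr rfl fun k _ => by rw [ih (by omega) k]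
  have := hMn n rfl (Fin.cast hNL.symm i) (x 0)
  simp only [Matrix.mulVec, dotProduct, hfwd n le_rfl]
  simpa using this

/-! ### Bounded functions -/

/-- The space of bounded functions on `ℝ`. -/
noncomputable def boundedFun : Submodule ℝ (ℝ → ℝ) where
  carrier := {f | ∃ C, ∀ x, |f x| ≤ C}
  zero_mem' := ⟨0, fun x => by simp⟩
  add_mem' := by
    rintro f g ⟨C, hC⟩ ⟨D, hD⟩
    exact ⟨C + D, fun x => (abs_add_le _ _).trans (add_le_add (hC x) (hD x))⟩
  smul_mem' := by
    rintro a f ⟨C, hC⟩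
    refine ⟨|a| * C, fun x => ?_⟩
    simpa [abs_mul] using mul_le_mul_of_nonneg_left (hC x) (abs_nonneg a)

theorem mem_boundedFun_of_nonneg_of_le {f : ℝ → ℝ} {C : ℝ} (h0 : ∀ x, 0 ≤ f x)
    (h1 : ∀ x, f x ≤ C) : f ∈ boundedFun :=
  ⟨C, fun x => by rw [abs_of_nonneg (h0 x)]; exact h1 x⟩

theorem exists_add_const_nonneg {f : ℝ → ℝ} (hf : f ∈ boundedFun) :
    ∃ C : ℝ, ∀ x, 0 ≤ f x + C := by
  obtain ⟨C, hC⟩ := hf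
  exact ⟨C, fun x => by linarith [neg_le_of_abs_le (hC x)]⟩

/-! ### Tents with breakpoints at prescribed nodes -/

theorem max_sum_zero_eq_sum_max {κ : Type*} (s : Finset κ) (c h : κ → ℝ) (hc : ∀ j ∈ s, 0 ≤ c j)
    (hd : ∀ j ∈ s, ∀ k ∈ s, j ≠ k → h j = 0 ∨ h k = 0) :
    max (∑ j ∈ s, c j * h j) 0 = ∑ j ∈ s, c j * max (h j) 0 := by
  by_cases hz : ∀ j ∈ s, h j = 0
  · rw [Finset.sum_eq_zero fun j hj => by rw [hz j hj, mul_zero],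
      Finset.sum_eq_zero fun j hj => by rw [hz j hj, max_self, mul_zero], max_self]
  · push Not at hz
    obtain ⟨k, hk, hk0⟩ := hz
    have h0 : ∀ j ∈ s, j ≠ k → h j = 0 := fun j hj hjk =>
      (hd j hj k hk hjk).resolve_right hk0
    rw [Finset.sum_eq_single_of_mem k hk fun j hj hjk => by rw [h0 j hj hjk, mul_zero],
      Finset.sum_eq_single_of_mem k hk fun j hj hjk => by rw [h0 j hj hjk, max_self, mul_zero],
      mul_max_of_nonneg _ _ (hc k hk), mul_zero]

/-- Negative of the slope of the tent to the right of its peak. -/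
noncomputable def tentSlope (ζ : ℕ → ℝ) (W : ℕ) (p : ℝ) (j : ℕ) : ℝ :=
  if j + 1 < W then (ζ (j + 2) - p) / (ζ (j + 3) - ζ (j + 2)) else 0

/-- Piecewise linear function with breakpoints `ζ j, …, ζ (j + 3)` that crosses zero upwards at `p`
with slope one. It is constant to the right of `ζ (j + 2)` if `j + 1 = W`. -/
noncomputable def tent (ζ : ℕ → ℝ) (W : ℕ) (p : ℝ) (j : ℕ) (t : ℝ) : ℝ :=
  -((p - ζ (j + 1)) / (ζ (j + 1) - ζ j)) * max (t - ζ j) 0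
    + ((p - ζ (j + 1)) / (ζ (j + 1) - ζ j) + 1) * max (t - ζ (j + 1)) 0
    - (1 + tentSlope ζ W p j) * max (t - ζ (j + 2)) 0
    + tentSlope ζ W p j * max (t - ζ (j + 3)) 0

theorem tent_eq_zero_of_le {ζ : ℕ → ℝ} (hζ : StrictMono ζ) {W : ℕ} {p : ℝ} {j : ℕ} {t : ℝ}
    (ht : t ≤ ζ j) : tent ζ W p j t = 0 := by
  have h1 := hζ (show j < j + 1 by omega)
  have h2 := hζ (show j < j + 2 by omega)
  have h3 := hζ (show j < j + 3 by omega)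
  rw [tent, max_eq_right (by linarith), max_eq_right (by linarith), max_eq_right (by linarith),
    max_eq_right (by linarith)]
  ring

theorem tent_eq_zero_of_ge {ζ : ℕ → ℝ} (hζ : StrictMono ζ) {W : ℕ} {p : ℝ} {j : ℕ}
    (hj : j + 1 < W) {t : ℝ} (ht : ζ (j + 3) ≤ t) : tent ζ W p j t = 0 := by
  have h1 := hζ (show j < j + 1 by omega)
  have h2 := hζ (show j + 1 < j + 2 by omega)
  have h3 := hζ (show j + 2 < j + 3 by omega)
  rw [tent, tentSlope, if_pos hj, max_eq_left (by linarith), max_eq_left (by linarith),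
    max_eq_left (by linarith), max_eq_left (by linarith)]
  have h1' : ζ (j + 1) - ζ j ≠ 0 := by linarith
  have h3' : ζ (j + 3) - ζ (j + 2) ≠ 0 := by linarith
  field_simp
  ring

theorem max_tent_zero {ζ : ℕ → ℝ} (hζ : StrictMono ζ) {W : ℕ} {p : ℝ} {j : ℕ}
    (hp1 : ζ (j + 1) ≤ p) (hp2 : p ≤ ζ (j + 2)) (t : ℝ) :
    max (tent ζ W p j t) 0 = max (t - p) 0 - (1 + tentSlope ζ W p j) * max (t - ζ (j + 2)) 0
      + tentSlope ζ W p j * max (t - ζ (j + 3)) 0 ∧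
    max (tent ζ W p j t) 0 ≤ ζ (j + 2) - p := by
  have h1 := hζ (show j < j + 1 by omega)
  have h2 := hζ (show j + 1 < j + 2 by omega)
  have h3 := hζ (show j + 2 < j + 3 by omega)
  have hα : 0 ≤ (p - ζ (j + 1)) / (ζ (j + 1) - ζ j) := div_nonneg (by linarith) (by linarith)
  have hα' : (p - ζ (j + 1)) / (ζ (j + 1) - ζ j) * (ζ (j + 1) - ζ j) = p - ζ (j + 1) :=
    div_mul_cancel₀ _ (by linarith)
  have hl : 0 ≤ tentSlope ζ W p j := by
    rw [tentSlope]
    split_ifs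
    · exact div_nonneg (by linarith) (by linarith)
    · exact le_rfl
  have hl' : tentSlope ζ W p j * (ζ (j + 3) - ζ (j + 2)) ≤ ζ (j + 2) - p := by
    rw [tentSlope]
    split_ifs
    · exact (div_mul_cancel₀ _ (by linarith)).le
    · linarith
  rw [tent]
  set α := (p - ζ (j + 1)) / (ζ (j + 1) - ζ j)
  set l := tentSlope ζ W p j
  rcases le_total t (ζ j) with ha | ha
  · rw [max_eq_right (a := t - ζ j) (by linarith), max_eq_right (a := t - ζ (j + 1)) (by linarith),
      max_eq_right (a := t - ζ (j + 2)) (by linarith),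
      max_eq_right (a := t - ζ (j + 3)) (by linarith), max_eq_right (a := t - p) (by linarith)]
    simp
    linarith
  rw [max_eq_left (a := t - ζ j) (by linarith)]
  rcases le_total t (ζ (j + 1)) with hb | hb
  · rw [max_eq_right (a := t - ζ (j + 1)) (by linarith),
      max_eq_right (a := t - ζ (j + 2)) (by linarith),
      max_eq_right (a := t - ζ (j + 3)) (by linarith), max_eq_right (a := t - p) (by linarith),
      max_eq_right]
    · simp
      linarith
    · nlinarith [mul_nonneg hα (sub_nonneg.2 ha)]
  rw [max_eq_left (a := t - ζ (j + 1)) (by linarith)]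
  have hlin : -α * (t - ζ j) + (α + 1) * (t - ζ (j + 1)) = t - p := by linear_combination -hα'
  rw [hlin]
  rcases le_total t (ζ (j + 2)) with hc | hc
  · rw [max_eq_right (a := t - ζ (j + 2)) (by linarith),
      max_eq_right (a := t - ζ (j + 3)) (by linarith)]
    simp only [mul_zero, sub_zero, add_zero, true_and]
    exact max_le (by linarith) (by linarith)
  rw [max_eq_left (a := t - ζ (j + 2)) (by linarith), max_eq_left (a := t - p) (by linarith)]
  have hlt : 0 ≤ l * (t - ζ (j + 2)) := mul_nonneg hl (by linarith)
  rcases le_total t (ζ (j + 3)) with he | he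
  · rw [max_eq_right (a := t - ζ (j + 3)) (by linarith), max_eq_left]
    · exact ⟨rfl, by nlinarith⟩
    · nlinarith [mul_nonneg hl (sub_nonneg.2 he)]
  · rw [max_eq_left (a := t - ζ (j + 3)) (by linarith), max_eq_left]
    · exact ⟨rfl, by nlinarith⟩
    · nlinarith

theorem tent_eq_zero_or {ζ : ℕ → ℝ} (hζ : StrictMono ζ) {W : ℕ} (p : ℕ → ℝ) {j k : ℕ}
    (hj : j < W) (hk : k < W) (hjk : j ≠ k) (hmod : j % 3 = k % 3) (t : ℝ) :
    tent ζ W (p j) j t = 0 ∨ tent ζ W (p k) k t = 0 := by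
  wlog h : j < k generalizing j k
  · exact (this hk hj hjk.symm hmod.symm (by omega)).symm
  rcases le_total t (ζ k) with ht | ht
  · exact Or.inr (tent_eq_zero_of_le hζ ht)
  · exact Or.inl (tent_eq_zero_of_ge hζ (by omega) ((hζ.monotone (by omega)).trans ht))

/-- A signed combination of tents is the difference of six neurons, grouped by residue mod `3`
and by sign. -/
theorem sum_mul_max_tent {ζ : ℕ → ℝ} (hζ : StrictMono ζ) (W : ℕ) (p c : ℕ → ℝ) (t : ℝ) :
    ∑ j ∈ Finset.range W, c j * max (tent ζ W (p j) j t) 0 =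
      ∑ r : Fin 3,
        (max (∑ j ∈ Finset.range W with j % 3 = (r : ℕ), max (c j) 0 * tent ζ W (p j) j t) 0
        - max (∑ j ∈ Finset.range W with j % 3 = (r : ℕ), max (-c j) 0 * tent ζ W (p j) j t) 0) := by
  have hd : ∀ r : Fin 3, ∀ j ∈ (Finset.range W).filter (fun j => j % 3 = (r : ℕ)),
      ∀ k ∈ (Finset.range W).filter (fun j => j % 3 = (r : ℕ)), j ≠ k →
      tent ζ W (p j) j t = 0 ∨ tent ζ W (p k) k t = 0 := by
    intro r j hj k hk hjk
    simp only [Finset.mem_filter, Finset.mem_range] at hj hk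
    exact tent_eq_zero_or hζ p hj.1 hk.1 hjk (hj.2.trans hk.2.symm) t
  have hr : ∀ r : Fin 3,
      max (∑ j ∈ Finset.range W with j % 3 = (r : ℕ), max (c j) 0 * tent ζ W (p j) j t) 0
        - max (∑ j ∈ Finset.range W with j % 3 = (r : ℕ), max (-c j) 0 * tent ζ W (p j) j t) 0
      = ∑ j ∈ Finset.range W with j % 3 = (r : ℕ), c j * max (tent ζ W (p j) j t) 0 := by
    intro r
    rw [max_sum_zero_eq_sum_max _ _ _ (fun _ _ => le_max_right _ _) (hd r),
      max_sum_zero_eq_sum_max _ _ _ (fun _ _ => le_max_right _ _) (hd r),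
      ← Finset.sum_sub_distrib]
    refine Finset.sum_congr rfl fun j _ => ?_
    rw [← sub_mul]
    congr 1
    rcases le_total 0 (c j) with h | h
    · rw [max_eq_left h, max_eq_right (by linarith), sub_zero]
    · rw [max_eq_right h, max_eq_left (by linarith)]; ring
  rw [Finset.sum_congr rfl fun r _ => hr r]
  rw [← Finset.sum_fiberwise_of_maps_to (t := (Finset.univ : Finset (Fin 3)))
    (g := fun j => (⟨j % 3, Nat.mod_lt _ (by norm_num)⟩ : Fin 3)) (fun _ _ => Finset.mem_univ _)]
  refine Finset.sum_congr rfl fun r _ => Finset.sum_congr ?_ fun _ _ => rfl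
  ext j
  simp [Fin.ext_iff]

/-- One more hidden layer adds to each `P o` a combination of the functions `min T (p j i)`, where
`p j i` lies between the consecutive nodes `ζ (j + 1)` and `ζ (j + 2)`. -/
theorem reluStep_add_sum_min {d W q : ℕ} (hcard : d * q * 6 ≤ W) {T : ℝ → ℝ} (hT : ∀ x, 0 ≤ T x)
    {ζ : ℕ → ℝ} (hζ : StrictMono ζ) (hζ0 : ζ 0 ≤ 0) (hζ1 : ζ 1 = 0) (p : ℕ → ℕ → ℝ)
    (hp1 : ∀ j i, i < q → ζ (j + 1) ≤ p j i) (hp2 : ∀ j i, i < q → p j i ≤ ζ (j + 2))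
    (c : Fin d → ℕ → ℕ → ℝ) (P : Fin d → ℝ → ℝ) (hP : ∀ o, P o ∈ boundedFun)
    {V : Submodule ℝ (ℝ → ℝ)} (h1V : 1 ∈ V) (hTV : T ∈ V) (hPV : ∀ o, P o ∈ V)
    (hζV : ∀ j, j < W → (fun x => max (T x - ζ (j + 2)) 0) ∈ V) :
    ReluStep (W + d + 1) V (Submodule.span ℝ (insert 1 (insert T (Set.range fun o =>
      P o + ∑ j ∈ Finset.range W, ∑ i ∈ Finset.range q,
        c o j i • fun x => min (T x) (p j i))))) := by
  set H : ℕ → ℕ → ℝ → ℝ := fun j i x => tent ζ W (p j i) j (T x) with hH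
  have hle : ∀ s : ℝ, s ≤ 0 → (fun x => max (T x - s) 0) ∈ V := by
    intro s hs
    have : (fun x => max (T x - s) 0) = T - s • 1 := by
      ext x
      simp [max_eq_left (by linarith [hT x] : 0 ≤ T x - s)]
    rw [this]
    exact V.sub_mem hTV (V.smul_mem _ h1V)
  have hnode : ∀ j, j < W + 2 → (fun x => max (T x - ζ j) 0) ∈ V := by
    intro j hj
    rcases j with _ | _ | j
    · exact hle _ hζ0
    · exact hle _ hζ1.le
    · exact hζV j (by omega)
  have hslope : ∀ j (a : ℝ), j < W → (tentSlope ζ W a j • fun x => max (T x - ζ (j + 3)) 0) ∈ V := by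
    intro j a hj
    by_cases h : j + 1 < W
    · exact V.smul_mem _ (hnode _ (by omega))
    · rw [tentSlope, if_neg h, zero_smul]
      exact V.zero_mem
  have hHV : ∀ j i, j < W → H j i ∈ V := by
    intro j i hj
    have : H j i = -((p j i - ζ (j + 1)) / (ζ (j + 1) - ζ j)) • (fun x => max (T x - ζ j) 0)
        + ((p j i - ζ (j + 1)) / (ζ (j + 1) - ζ j) + 1) • (fun x => max (T x - ζ (j + 1)) 0)
        - (1 + tentSlope ζ W (p j i) j) • (fun x => max (T x - ζ (j + 2)) 0)
        + tentSlope ζ W (p j i) j • (fun x => max (T x - ζ (j + 3)) 0) := rfl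
    rw [this]
    exact V.add_mem (V.sub_mem (V.add_mem (V.smul_mem _ (hnode _ (by omega)))
      (V.smul_mem _ (hnode _ (by omega)))) (V.smul_mem _ (hnode _ (by omega)))) (hslope _ _ hj)
  let E : ℕ → ℕ → ℝ → ℝ := fun j i => (fun x => min (T x) (p j i)) + fun x => max (H j i x) 0
  have hE : ∀ j i, i < q → E j i = T
      - (1 + tentSlope ζ W (p j i) j) • (fun x => max (T x - ζ (j + 2)) 0)
      + tentSlope ζ W (p j i) j • (fun x => max (T x - ζ (j + 3)) 0) := by
    intro j i hi
    ext x
    have := (max_tent_zero hζ (W := W) (hp1 j i hi) (hp2 j i hi) (T x)).1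
    have hm : min (T x) (p j i) + max (T x - p j i) 0 = T x := by
      rcases le_total (T x) (p j i) with h | h
      · rw [min_eq_left h, max_eq_right (by linarith), add_zero]
      · rw [min_eq_right h, max_eq_left (by linarith)]; ring
    simp only [E, hH, Pi.add_apply, Pi.sub_apply, Pi.smul_apply, smul_eq_mul, this]
    linear_combination hm
  have hEV : ∀ j i, j < W → i < q → E j i ∈ V := by
    intro j i hj hi
    rw [hE j i hi]
    exact V.add_mem (V.sub_mem hTV (V.smul_mem _ (hnode _ (by omega)))) (hslope _ _ hj)
  have hEb : ∀ j i, i < q → E j i ∈ boundedFun := by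
    intro j i hi
    have hp0 : 0 ≤ p j i := by
      have := hζ.monotone (show 1 ≤ j + 1 by omega)
      linarith [hp1 j i hi]
    exact boundedFun.add_mem
      (mem_boundedFun_of_nonneg_of_le (fun x => le_min (hT x) hp0) fun x => min_le_right _ _)
      (mem_boundedFun_of_nonneg_of_le (fun x => le_max_right _ _) fun x =>
        (max_tent_zero hζ (hp1 j i hi) (hp2 j i hi) (T x)).2)
  let Q : Fin d → ℝ → ℝ := fun o =>
    P o + ∑ j ∈ Finset.range W, ∑ i ∈ Finset.range q, c o j i • E j i
  have hQV : ∀ o, Q o ∈ V := fun o =>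
    V.add_mem (hPV o) (V.sum_mem fun j hj => V.sum_mem fun i hi =>
      V.smul_mem _ (hEV j i (Finset.mem_range.1 hj) (Finset.mem_range.1 hi)))
  have hQb : ∀ o, Q o ∈ boundedFun := fun o =>
    boundedFun.add_mem (hP o) (boundedFun.sum_mem fun j _ => boundedFun.sum_mem fun i hi =>
      boundedFun.smul_mem _ (hEb j i (Finset.mem_range.1 hi)))
  choose C hC using fun o => exists_add_const_nonneg (hQb o)
  let U : Fin d → ℕ → Fin 3 → Bool → ℝ → ℝ := fun o i r s =>
    ∑ j ∈ Finset.range W with j % 3 = (r : ℕ), max (bif s then c o j i else -c o j i) 0 • H j i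
  have hUV : ∀ o i r s, U o i r s ∈ V := fun o i r s =>
    V.sum_mem fun j hj => V.smul_mem _
      (hHV j i (Finset.mem_range.1 (Finset.mem_filter.1 hj).1))
  let S : Unit ⊕ Fin d ⊕ (Fin d × Fin q × Fin 3 × Bool) → ℝ → ℝ :=
    Sum.elim (fun _ => T) (Sum.elim (fun o => Q o + C o • 1)
      fun a x => max (U a.1 a.2.1 a.2.2.1 a.2.2.2 x) 0)
  have hSmem : ∀ k, S k ∈ Submodule.span ℝ (insert 1 (Set.range S)) := fun k =>
    Submodule.subset_span (Set.mem_insert_of_mem _ ⟨k, rfl⟩)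
  have h1mem : (1 : ℝ → ℝ) ∈ Submodule.span ℝ (insert 1 (Set.range S)) :=
    Submodule.subset_span (Set.mem_insert _ _)
  refine ReluStep.of_fintype ?_ S ?_ ?_
  · simp only [Fintype.card_sum, Fintype.card_prod, Fintype.card_fin, Fintype.card_unit,
      Fintype.card_bool]
    have : d * (q * (3 * 2)) = d * q * 6 := by ring
    omega
  · rintro (_ | o | a)
    · exact ⟨T, hTV, fun x => (max_eq_left (hT x)).symm⟩
    · exact ⟨Q o + C o • 1, V.add_mem (hQV o) (V.smul_mem _ h1V), fun x =>
        (max_eq_left (by simpa [S] using hC o x)).symm⟩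
    · exact ⟨_, hUV a.1 a.2.1 a.2.2.1 a.2.2.2, fun x => rfl⟩
  · refine Submodule.span_le.2 (Set.insert_subset h1mem (Set.insert_subset
      (hSmem (Sum.inl ())) ?_))
    rintro _ ⟨o, rfl⟩
    have hEq : P o + ∑ j ∈ Finset.range W, ∑ i ∈ Finset.range q,
          c o j i • (fun x => min (T x) (p j i)) =
        S (Sum.inr (Sum.inl o)) - C o • 1 - ∑ i : Fin q, ∑ r : Fin 3,
          (S (Sum.inr (Sum.inr (o, i, r, true))) - S (Sum.inr (Sum.inr (o, i, r, false)))) := by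
      ext x
      have hsum : ∑ i : Fin q, ∑ r : Fin 3, (max (U o i r true x) 0 - max (U o i r false x) 0)
          = ∑ j ∈ Finset.range W, ∑ i ∈ Finset.range q, c o j i * max (H j i x) 0 := by
        conv_rhs => rw [Finset.sum_comm]
        rw [← Fin.sum_univ_eq_sum_range
          (fun i => ∑ j ∈ Finset.range W, c o j i * max (H j i x) 0) q]
        refine Finset.sum_congr rfl fun i _ => ?_
        rw [sum_mul_max_tent hζ W (fun j => p j i) (fun j => c o j i) (T x)]
        simp [U, hH, Finset.sum_apply]
      simp only [S, Q, E, Sum.elim_inl, Sum.elim_inr, Pi.add_apply, Pi.sub_apply, Pi.smul_apply,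
        Finset.sum_apply, smul_eq_mul, Pi.one_apply, hsum, mul_add, Finset.sum_add_distrib]
      ring
    rw [SetLike.mem_coe]
    beta_reduce
    rw [hEq]
    exact Submodule.sub_mem _ (Submodule.sub_mem _ (hSmem _) (Submodule.smul_mem _ _ h1mem))
      (Submodule.sum_mem _ fun i _ => Submodule.sum_mem _ fun r _ =>
        Submodule.sub_mem _ (hSmem _) (hSmem _))

/-- One hidden layer that stores `T`, the bounded functions `P o`, and new neurons
`max (T - ξ j) 0`. -/
theorem reluStep_nodes {d W : ℕ} {T : ℝ → ℝ} (hT : ∀ x, 0 ≤ T x) (ξ : ℕ → ℝ)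
    (P : Fin d → ℝ → ℝ) (hP : ∀ o, P o ∈ boundedFun) {V : Submodule ℝ (ℝ → ℝ)}
    (h1V : 1 ∈ V) (hTV : T ∈ V) (hPV : ∀ o, P o ∈ V) :
    ReluStep (W + d + 1) V (Submodule.span ℝ (insert 1 (insert T (Set.range P ∪
      Set.range fun (j : Fin W) x => max (T x - ξ j) 0)))) := by
  choose C hC using fun o => exists_add_const_nonneg (hP o)
  let S : Unit ⊕ Fin d ⊕ Fin W → ℝ → ℝ :=
    Sum.elim (fun _ => T) (Sum.elim (fun o => P o + C o • 1) fun j x => max (T x - ξ j) 0)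
  have hSmem : ∀ k, S k ∈ Submodule.span ℝ (insert 1 (Set.range S)) := fun k =>
    Submodule.subset_span (Set.mem_insert_of_mem _ ⟨k, rfl⟩)
  have h1mem : (1 : ℝ → ℝ) ∈ Submodule.span ℝ (insert 1 (Set.range S)) :=
    Submodule.subset_span (Set.mem_insert _ _)
  refine ReluStep.of_fintype ?_ S ?_ ?_
  · simp only [Fintype.card_sum, Fintype.card_fin, Fintype.card_unit]
    omega
  · rintro (_ | o | j)
    · exact ⟨T, hTV, fun x => (max_eq_left (hT x)).symm⟩
    · exact ⟨P o + C o • 1, V.add_mem (hPV o) (V.smul_mem _ h1V), fun x =>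
        (max_eq_left (by simpa [S] using hC o x)).symm⟩
    · exact ⟨T - ξ j • 1, V.sub_mem hTV (V.smul_mem _ h1V), fun x => by simp [S]⟩
  · refine Submodule.span_le.2 (Set.insert_subset h1mem (Set.insert_subset
      (hSmem (Sum.inl ())) (Set.union_subset ?_ ?_)))
    · rintro _ ⟨o, rfl⟩
      have : P o = S (Sum.inr (Sum.inl o)) - C o • 1 := by simp [S]
      rw [SetLike.mem_coe, this]
      exact Submodule.sub_mem _ (hSmem _) (Submodule.smul_mem _ _ h1mem)
    · rintro _ ⟨j, rfl⟩
      exact hSmem (Sum.inr (Sum.inr j))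

/-- The first hidden layer: `T` is the positive part of `x - a`, and each `P o` is a multiple of
`min T s`. -/
theorem reluStep_nodes_of_id {d W : ℕ} (hd : 0 < d) (a s : ℝ) (hs : 0 ≤ s) (ξ : ℕ → ℝ)
    (hξ : ∀ j, 0 ≤ ξ j) (e : Fin d → ℝ) :
    ReluStep (W + d + 1) (Submodule.span ℝ {1, id})
      (Submodule.span ℝ (insert 1 (insert (fun x => max (x - a) 0)
        (Set.range (fun o => e o • fun x => min (max (x - a) 0) s) ∪
          Set.range fun (j : Fin W) x => max (max (x - a) 0 - ξ j) 0)))) := by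
  have h1V : (1 : ℝ → ℝ) ∈ Submodule.span ℝ {1, id} := Submodule.subset_span (by simp)
  have hidV : (id : ℝ → ℝ) ∈ Submodule.span ℝ {1, id} := Submodule.subset_span (by simp)
  have hmax : ∀ t, 0 ≤ t → ∀ x, max (max (x - a) 0 - t) 0 = max (x - (a + t)) 0 := by
    intro t ht x
    rcases le_total 0 (x - a) with h | h
    · rw [max_eq_left h]; ring_nf
    · rw [max_eq_right h, max_eq_right (by linarith), max_eq_right (by linarith)]
  let S : Unit ⊕ Unit ⊕ Fin W → ℝ → ℝ :=
    Sum.elim (fun _ x => max (x - a) 0) (Sum.elim (fun _ x => max (max (x - a) 0 - s) 0)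
      fun j x => max (max (x - a) 0 - ξ j) 0)
  have hSmem : ∀ k, S k ∈ Submodule.span ℝ (insert 1 (Set.range S)) := fun k =>
    Submodule.subset_span (Set.mem_insert_of_mem _ ⟨k, rfl⟩)
  have h1mem : (1 : ℝ → ℝ) ∈ Submodule.span ℝ (insert 1 (Set.range S)) :=
    Submodule.subset_span (Set.mem_insert _ _)
  have hneuron : ∀ t : ℝ, id - t • (1 : ℝ → ℝ) ∈ Submodule.span ℝ {1, id} := fun t =>
    Submodule.sub_mem _ hidV (Submodule.smul_mem _ _ h1V)
  refine ReluStep.of_fintype ?_ S ?_ ?_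
  · simp only [Fintype.card_sum, Fintype.card_fin, Fintype.card_unit]
    omega
  · rintro (_ | _ | j)
    · exact ⟨_, hneuron a, fun x => by simp [S]⟩
    · exact ⟨_, hneuron (a + s), fun x => by simpa [S] using hmax s hs x⟩
    · exact ⟨_, hneuron (a + ξ j), fun x => by simpa [S] using hmax _ (hξ j) x⟩
  · refine Submodule.span_le.2 (Set.insert_subset h1mem (Set.insert_subset
      (hSmem (Sum.inl ())) (Set.union_subset ?_ ?_)))
    · rintro _ ⟨o, rfl⟩
      have : (fun x => min (max (x - a) 0) s) =
          S (Sum.inl ()) - S (Sum.inr (Sum.inl ())) := by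
        ext x
        simp only [S, Sum.elim_inl, Sum.elim_inr, Pi.sub_apply]
        rcases le_total (max (x - a) 0) s with h | h
        · rw [min_eq_left h, max_eq_right (a := max (x - a) 0 - s) (by linarith), sub_zero]
        · rw [min_eq_right h, max_eq_left (a := max (x - a) 0 - s) (by linarith)]; ring
      simp only [SetLike.mem_coe, this]
      exact Submodule.smul_mem _ _ (Submodule.sub_mem _ (hSmem _) (hSmem _))
    · rintro _ ⟨j, rfl⟩
      exact hSmem (Sum.inr (Sum.inr j))

/-! ### Decomposition of piecewise linear functions -/

theorem sum_range_mul_eq_sum_sum {A : Type*} [AddCommMonoid A] (f : ℕ → A) (m q : ℕ) :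
    ∑ k ∈ Finset.range (m * q), f k =
      ∑ j ∈ Finset.range m, ∑ i ∈ Finset.range q, f (j * q + i) := by
  induction m with
  | zero => simp
  | succ m ih => rw [Nat.succ_mul, Finset.sum_range_add, ih, Finset.sum_range_succ]

/-- A function that is affine between consecutive breakpoints and constant outside is a combination
of the functions `min (max (x - Y 0) 0) (Y (k + 1) - Y 0)`. -/
theorem eq_add_sum_min {Y : ℕ → ℝ} (hY : StrictMono Y) {f : ℝ → ℝ} {m b : ℕ → ℝ}
    (hf : ∀ k, ∀ x ∈ Set.Icc (Y k) (Y (k + 1)), f x = x * m k + b k)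
    (hleft : ∀ x ≤ Y 0, f x = f (Y 0)) {n : ℕ} (hm : m (n + 1) = 0)
    (hright : ∀ x, Y (n + 1) ≤ x → f x = f (Y (n + 1))) (x : ℝ) :
    f x = f (Y 0) + ∑ k ∈ Finset.range (n + 1),
      (m k - m (k + 1)) * min (max (x - Y 0) 0) (Y (k + 1) - Y 0) := by
  set M : ℕ → ℝ := fun k => min (max (x - Y 0) 0) (Y k - Y 0) with hM
  have hM0 : M 0 = 0 := by simp [hM]
  have hrearr : ∑ k ∈ Finset.range (n + 1), (m k - m (k + 1)) * M (k + 1) =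
      ∑ k ∈ Finset.range (n + 1), m k * (M (k + 1) - M k) := by
    have h1 := Finset.sum_range_succ' (fun k => m k * M k) (n + 1)
    have h2 := Finset.sum_range_succ (fun k => m k * M k) (n + 1)
    simp only [hM0, hm, zero_mul, mul_zero, add_zero] at h1 h2
    simp only [sub_mul, mul_sub, Finset.sum_sub_distrib]
    rw [← h1, h2]
  have hmono := hY.monotone
  change f x = f (Y 0) + ∑ k ∈ Finset.range (n + 1), (m k - m (k + 1)) * M (k + 1)
  rw [hrearr]
  rcases le_total x (Y 0) with hx | hx
  · have hz : ∀ k, M k = 0 := fun k => by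
      have := hmono (Nat.zero_le k)
      simp only [hM]
      rw [max_eq_right (by linarith), min_eq_left (by linarith)]
    simp [hz, hleft x hx]
  · have hMx : ∀ k, M k = min x (Y k) - Y 0 := fun k => by
      simp only [hM]
      rw [max_eq_left (by linarith), min_sub_sub_right]
    have hpart : ∀ K, f (min x (Y K)) = f (Y 0) + ∑ k ∈ Finset.range K, m k * (M (k + 1) - M k) := by
      intro K
      induction K with
      | zero => simp [min_eq_right hx]
      | succ K ih =>
        rw [Finset.sum_range_succ, ← add_assoc, ← ih, hMx, hMx]
        have hK := hmono (Nat.le_succ K)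
        rcases le_total x (Y K) with h | h
        · rw [min_eq_left h, min_eq_left (h.trans hK)]; ring
        · rw [min_eq_right h, hf K _ ⟨le_min h hK, min_le_right _ _⟩, hf K (Y K) ⟨le_rfl, hK⟩]
          ring
    rw [← hpart]
    rcases le_total x (Y (n + 1)) with h | h
    · rw [min_eq_left h]
    · rw [min_eq_right h, hright x h]

theorem exists_strictMono_extension {n : ℕ} (z : Fin (n + 2) → ℝ) (hz : StrictMono z) :
    ∃ Y : ℕ → ℝ, StrictMono Y ∧ ∀ k (h : k < n + 2), Y k = z ⟨k, h⟩ := by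
  refine ⟨fun k => if h : k < n + 2 then z ⟨k, h⟩ else z (Fin.last _) + (k - (n + 1) : ℝ),
    strictMono_nat_of_lt_succ fun k => ?_, fun k h => dif_pos h⟩
  rcases lt_trichotomy k (n + 1) with h | h | h
  · rw [dif_pos (by omega), dif_pos (by omega)]
    exact hz (Fin.mk_lt_mk.2 (Nat.lt_succ_self k))
  · subst h
    rw [dif_pos (by omega), dif_neg (by omega)]
    push_cast
    change z (Fin.last _) < _
    linarith
  · rw [dif_neg (by omega), dif_neg (by omega)]
    push_cast
    linarith

theorem SpaceS.exists_eq_add_sum_min {d N n : ℕ} (hn : N ≤ n) {z : Fin (N + 2) → ℝ}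
    (hz : StrictMono z) {φ : ℝ → EuclideanSpace ℝ (Fin d)} (hφ : φ ∈ SpaceS d N z) :
    ∃ (y : ℕ → ℝ) (c : Fin d → ℕ → ℝ), StrictMono y ∧ y 0 = 0 ∧ ∀ o x,
      φ x o = φ (z 0) o + ∑ k ∈ Finset.range (n + 1),
        c o k * min (max (x - z 0) 0) (y (k + 1)) := by
  obtain ⟨Y, hY, hYz⟩ := exists_strictMono_extension z hz
  obtain ⟨-, hleft, hright, haff⟩ := hφ
  have hY0 : Y 0 = z 0 := hYz 0 (by omega)
  have hYN : Y (N + 1) = z (Fin.last (N + 1)) := hYz (N + 1) (by omega)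
  rw [← hYN] at hright
  have hpiece : ∀ k, ∃ a b : EuclideanSpace ℝ (Fin d),
      (∀ x ∈ Set.Icc (Y k) (Y (k + 1)), φ x = x • a + b) ∧ (N < k → a = 0) := by
    intro k
    rcases lt_or_ge N k with h | h
    · refine ⟨0, φ (Y (N + 1)), fun x hx => ?_, fun _ => rfl⟩
      rw [smul_zero, zero_add, hright x ((hY.monotone (by omega)).trans hx.1)]
    · obtain ⟨a, b, hab⟩ := haff ⟨k, by omega⟩
      refine ⟨a, b, fun x hx => hab x ?_, fun h' => absurd h' (by omega)⟩
      rw [hYz k (by omega), hYz (k + 1) (by omega)] at hx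
      exact hx
  choose m b hmb hm0 using hpiece
  refine ⟨fun k => Y k - Y 0, fun o k => m k o - m (k + 1) o, fun i j h =>
    sub_lt_sub_right (hY h) _, sub_self _, fun o x => ?_⟩
  rw [← hY0] at hleft ⊢
  refine eq_add_sum_min (f := fun x => φ x o) (m := fun k => m k o) (b := fun k => b k o) hY
    (fun k x hx => ?_) (fun x hx => ?_) ?_ (fun x hx => ?_) x
  · simp [hmb k x hx]
  · simp only [hleft x hx]
  · simp [hm0 (n + 1) (by omega)]
  · have := hY.monotone (show N + 1 ≤ n + 1 by omega)
    simp only [hright x (this.trans hx), hright _ this]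

/-! ### The network -/

/-- Part of a piecewise linear function accumulated after the first `k` terms. -/
noncomputable def partialMinSum (T : ℝ → ℝ) (y c : ℕ → ℝ) (e s : ℝ) (k : ℕ) : ℝ → ℝ :=
  e • (fun x => min (T x) s) + ∑ i ∈ Finset.range k, c i • fun x => min (T x) (y (i + 1))

theorem partialMinSum_mem_boundedFun {T : ℝ → ℝ} (hT : ∀ x, 0 ≤ T x) {y : ℕ → ℝ}
    (hy : ∀ k, 0 ≤ y k) (c : ℕ → ℝ) (e : ℝ) {s : ℝ} (hs : 0 ≤ s) (k : ℕ) :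
    partialMinSum T y c e s k ∈ boundedFun := by
  have h : ∀ t, 0 ≤ t → (fun x => min (T x) t) ∈ boundedFun := fun t ht =>
    mem_boundedFun_of_nonneg_of_le (fun x => le_min (hT x) ht) fun x => min_le_right _ _
  exact boundedFun.add_mem (boundedFun.smul_mem _ (h s hs))
    (boundedFun.sum_mem fun i _ => boundedFun.smul_mem _ (h _ (hy _)))

theorem partialMinSum_succ_mul (T : ℝ → ℝ) (y c : ℕ → ℝ) (e s : ℝ) (W q b : ℕ) :
    partialMinSum T y c e s ((b + 1) * (W * q)) = partialMinSum T y c e s (b * (W * q)) +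
      ∑ j ∈ Finset.range W, ∑ i ∈ Finset.range q,
        c (b * (W * q) + (j * q + i)) • fun x => min (T x) (y (b * (W * q) + (j * q + i) + 1)) := by
  rw [← sum_range_mul_eq_sum_sum
      (fun k => c (b * (W * q) + k) • fun x => min (T x) (y (b * (W * q) + k + 1))),
    partialMinSum, partialMinSum, Nat.succ_mul, Finset.sum_range_add, add_assoc]

/-- Two virtual nodes followed by the last point of each group of `q` points among `y (k + 1), …`. -/
def blockNode (y : ℕ → ℝ) (q k : ℕ) : ℕ → ℝ
  | 0 => -1
  | 1 => 0
  | j + 2 => y (k + (j * q + q))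

theorem strictMono_blockNode {y : ℕ → ℝ} (hy : StrictMono y) (hy0 : y 0 = 0) {q : ℕ} (hq : 0 < q)
    (k : ℕ) : StrictMono (blockNode y q k) := by
  refine strictMono_nat_of_lt_succ fun j => ?_
  rcases j with _ | _ | j
  · exact neg_one_lt_zero
  · exact hy0.symm.trans_lt (hy (by omega))
  · exact hy (by rw [Nat.succ_mul]; omega)

theorem blockNode_le {y : ℕ → ℝ} (hy : StrictMono y) (hy0 : y 0 = 0) (q k j i : ℕ) :
    blockNode y q k (j + 1) ≤ y (k + (j * q + i) + 1) := by
  rcases j with _ | j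
  · exact hy0.symm.trans_le (hy.monotone (by omega))
  · exact hy.monotone (by rw [Nat.succ_mul]; omega)

/-- Lemma: continuous piecewise linear functions with
`N ≤ W ⌊W/(6d)⌋ L` breakpoints are representable by ReLU networks of width `W + d + 1` and
depth `2L`. -/
theorem statement13 (d W L N : ℕ) (hd : 0 < d) (hW : 6 * d ≤ W) (hL : 1 ≤ L)
    (hN : N ≤ W * (W / (6 * d)) * L)
    (z : Fin (N + 2) → ℝ) (hz : StrictMono z) :
    ∀ φ ∈ SpaceS d N z,
      (fun x : EuclideanSpace ℝ (Fin 1) => φ (x 0)) ∈ NNset 1 d (W + d + 1) (2 * L) := by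
  intro φ hφ
  obtain ⟨y, c, hy, hy0, hφc⟩ := SpaceS.exists_eq_add_sum_min hN hz hφ
  set q := W / (6 * d)
  set n := W * q * L
  have hq : 0 < q := Nat.div_pos hW (by omega)
  have hcard : d * q * 6 ≤ W := by
    have := Nat.div_mul_le_self W (6 * d)
    calc d * q * 6 = q * (6 * d) := by ring
      _ ≤ W := this
  have hynn : ∀ k, 0 ≤ y k := fun k => hy0.symm.trans_le (hy.monotone (Nat.zero_le k))
  let T : ℝ → ℝ := fun x => max (x - z 0) 0
  have hT : ∀ x, 0 ≤ T x := fun x => le_max_right _ _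
  let P : ℕ → Fin d → ℝ → ℝ := fun b o =>
    partialMinSum T y (c o) (c o n) (y (n + 1)) (b * (W * q))
  have hP : ∀ b o, P b o ∈ boundedFun := fun b o =>
    partialMinSum_mem_boundedFun hT hynn _ _ (hynn _) _
  let ξ : ℕ → ℕ → ℝ := fun b j => blockNode y q (b * (W * q)) (j + 2)
  let Vodd : ℕ → Submodule ℝ (ℝ → ℝ) := fun b => Submodule.span ℝ (insert 1 (insert T
    (Set.range (P b) ∪ Set.range fun (j : Fin W) x => max (T x - ξ b j) 0)))
  let Veven : ℕ → Submodule ℝ (ℝ → ℝ) := fun b =>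
    Submodule.span ℝ (insert 1 (insert T (Set.range (P b))))
  let V : ℕ → Submodule ℝ (ℝ → ℝ) := fun l =>
    if l = 0 then Submodule.span ℝ {1, id} else if l % 2 = 1 then Vodd (l / 2) else Veven (l / 2)
  refine mem_NNset_of_reluStep (by omega) V (by simp [V]) (fun l => ?_) φ fun o => ?_
  · rcases Nat.eq_zero_or_pos l with rfl | hl
    · have h := reluStep_nodes_of_id (W := W) hd (z 0) (y (n + 1)) (hynn _) (ξ 0)
        (fun j => hynn _) fun o => c o n
      have hP0 : P 0 = fun o => c o n • fun x => min (T x) (y (n + 1)) := by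
        funext o
        simp [P, partialMinSum]
      have h0 : V 0 = Submodule.span ℝ {1, id} := if_pos rfl
      have h1 : V (0 + 1) = Vodd 0 := by simp [V]
      rw [h0, h1]
      simp only [Vodd, hP0]
      exact h
    · rcases Nat.mod_two_eq_zero_or_one l with h2 | h2
      · have h0 : V l = Veven (l / 2) := by simp [V, hl.ne', h2]
        have h1 : V (l + 1) = Vodd (l / 2) := by
          simp only [V]
          rw [if_neg (by omega), if_pos (by omega), show (l + 1) / 2 = l / 2 by omega]
        rw [h0, h1]
        exact reluStep_nodes hT _ _ (hP _) (Submodule.subset_span (by simp))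
          (Submodule.subset_span (by simp)) fun o => Submodule.subset_span (by simp)
      · have h0 : V l = Vodd (l / 2) := by simp [V, hl.ne', h2]
        have h1 : V (l + 1) = Veven (l / 2 + 1) := by
          simp only [V]
          rw [if_neg (by omega), if_neg (by omega), show (l + 1) / 2 = l / 2 + 1 by omega]
        rw [h0, h1]
        have h := reluStep_add_sum_min hcard hT
          (strictMono_blockNode hy hy0 hq (l / 2 * (W * q))) neg_one_lt_zero.le rfl
          (fun j i => y (l / 2 * (W * q) + (j * q + i) + 1))
          (fun j i _ => blockNode_le hy hy0 q _ j i)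
          (fun j i hi => hy.monotone (by omega))
          (fun o j i => c o (l / 2 * (W * q) + (j * q + i))) (P (l / 2)) (hP _)
          (V := Vodd (l / 2))
          (Submodule.subset_span (by simp)) (Submodule.subset_span (by simp))
          (fun o => Submodule.subset_span (by simp))
          (fun j hj => Submodule.subset_span (Set.mem_insert_of_mem _ (Set.mem_insert_of_mem _
            (Or.inr ⟨⟨j, hj⟩, rfl⟩))))
        have hP1 : P (l / 2 + 1) = fun o => _ := funext fun o =>
          partialMinSum_succ_mul T y (c o) (c o n) (y (n + 1)) W q (l / 2)
        simp only [Veven, hP1]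
        exact h
  · have hVL : V (2 * L) = Veven L := by
      simp only [V]
      rw [if_neg (by omega), if_neg (by omega), show 2 * L / 2 = L by omega]
    have hφP : (fun x => φ x o) = φ (z 0) o • 1 + P L o := by
      ext x
      rw [hφc, Finset.sum_range_succ]
      simp only [P, partialMinSum, T, Pi.add_apply, Pi.smul_apply, Finset.sum_apply, smul_eq_mul,
        Pi.one_apply, mul_one, show L * (W * q) = n from mul_comm _ _]
      ring
    rw [hVL, hφP]
    exact Submodule.add_mem _ (Submodule.smul_mem _ _ (Submodule.subset_span (by simp)))
      (Submodule.subset_span (by simp))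
end

section
/- Let $\mu$ be a probability measure on $\mathbb{R}^d$, suppose there exist $t > 0$, $r_0 > 0$ and a compact set $K \subseteq \mathbb{R}^d$ with $\mu(K) > 0$ such that $\mu(B(x,r)) \le r^t$ for all $x \in K$ and all $0 < r \le r_0$. Then for every $\delta < \mu(K)/2$ and every measurable set $S$ with $\mu(S) \ge 1-\delta$, and every $\epsilon$ with $2\epsilon \le r_0$, the covering number satisfies $\mathcal{N}_\epsilon(S) \ge (2\epsilon)^{-t} \mu(K)/2$; consequently $d_*(\mu) \ge t$. -/
open MeasureTheory Filter Topology Metric Set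
open scoped ENNReal NNReal

/-- If balls of radius `2 ε` centred in `K` have mass at most `m`, then covering `S` by balls of
radius `ε` requires at least `μ (S ∩ K) / m` balls. -/
lemma measure_inter_div_le_coveringNumber {E : Type*} [PseudoMetricSpace E] [MeasurableSpace E]
    {μ : Measure E} {K S : Set E} {ε : ℝ} {m : ℝ≥0∞}
    (hball : ∀ x ∈ K, μ (ball x (2 * ε)) ≤ m) :
    μ (S ∩ K) / m ≤ (coveringNumber ε S : ℝ≥0∞) := by
  simp only [_root_.coveringNumber, ENat.toENNReal_iInf, ENat.toENNReal_coe]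
  refine le_iInf₂ fun s hs => ENNReal.div_le_of_le_mul ?_
  have hsub : S ∩ K ⊆ ⋃ x ∈ s, ball x ε ∩ K := fun y hy => by
    simpa [hy.2] using hs hy.1
  calc μ (S ∩ K) ≤ ∑ x ∈ s, μ (ball x ε ∩ K) :=
        (measure_mono hsub).trans (measure_biUnion_finset_le _ _)
    _ ≤ ∑ _x ∈ s, m := by
        refine Finset.sum_le_sum fun x _ => ?_
        rcases (ball x ε ∩ K).eq_empty_or_nonempty with h | ⟨y, hyx, hyK⟩
        · simp [h]
        · refine (measure_mono ?_).trans (hball y hyK)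
          refine inter_subset_left.trans (ball_subset_ball' ?_)
          have := mem_ball'.1 hyx
          linarith
    _ = (s.card : ℝ≥0∞) * m := by simp

lemma half_measure_le_measure_inter {E : Type*} [MeasurableSpace E] {μ : Measure E}
    [IsProbabilityMeasure μ] {K S : Set E} {a : ℝ≥0∞}
    (hK : MeasurableSet K) (ha : a ≤ μ K / 2) (hS : 1 - a ≤ μ S) :
    μ K / 2 ≤ μ (S ∩ K) := by
  have hfin : μ Kᶜ + a ≠ ⊤ :=
    ENNReal.add_ne_top.2 ⟨measure_ne_top _ _, ne_top_of_le_ne_top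
      (ENNReal.div_ne_top (measure_ne_top _ _) two_ne_zero) ha⟩
  refine (ENNReal.add_le_add_iff_left hfin).1 ?_
  calc μ Kᶜ + a + μ K / 2 ≤ μ Kᶜ + μ K / 2 + μ K / 2 := by gcongr
    _ = 1 := by rw [add_assoc, ENNReal.add_halves, add_comm, prob_add_prob_compl hK]
    _ ≤ μ S + a := tsub_le_iff_right.1 hS
    _ ≤ μ (S ∩ K) + μ Kᶜ + a := by
        gcongr
        rw [← measure_inter_add_sdiff S hK]
        gcongr
        exact sdiff_subset_compl S K
    _ = μ Kᶜ + a + μ (S ∩ K) := by ring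

lemma mul_measure_div_two_le_coveringNumber {E : Type*} [PseudoMetricSpace E]
    [MeasurableSpace E] {μ : Measure E} [IsProbabilityMeasure μ] {K S : Set E} {a : ℝ≥0∞} {t ε : ℝ}
    (hK : MeasurableSet K) (ha : a ≤ μ K / 2) (hS : 1 - a ≤ μ S) (hε : 0 < ε)
    (hball : ∀ x ∈ K, μ (ball x (2 * ε)) ≤ ENNReal.ofReal ((2 * ε) ^ t)) :
    ENNReal.ofReal ((2 * ε) ^ (-t)) * μ K / 2 ≤ (coveringNumber ε S : ℝ≥0∞) := by
  have hpos : 0 < (2 * ε) ^ t := by positivity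
  rw [Real.rpow_neg (by positivity), ENNReal.ofReal_inv_of_pos hpos, mul_div_assoc, mul_comm,
    ← div_eq_mul_inv]
  exact (ENNReal.div_le_div_right (half_measure_le_measure_inter hK ha hS) _).trans
    (measure_inter_div_le_coveringNumber hball)

lemma ofReal_logb_le_elog2 {x : ℝ} (hx : 0 < x) {n : ℕ∞} (h : ENNReal.ofReal x ≤ (n : ℝ≥0∞)) :
    ENNReal.ofReal (Real.logb 2 x) ≤ elog2 n := by
  unfold elog2
  split_ifs with hn
  · exact le_top
  · lift n to ℕ using hn
    have hxn : x ≤ n := by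
      rw [← ENNReal.ofReal_le_ofReal_iff (Nat.cast_nonneg n)]
      simpa using h
    simpa using ENNReal.ofReal_le_ofReal (Real.logb_le_logb_of_le one_lt_two hx hxn)

lemma ofReal_le_liminf_elog2_div {N : ℝ → ℕ∞} {c t : ℝ} (hc : 0 < c)
    (hN : ∀ᶠ ε in 𝓝[>] (0 : ℝ), ENNReal.ofReal ((2 * ε) ^ (-t) * c) ≤ (N ε : ℝ≥0∞)) :
    ENNReal.ofReal t ≤ liminf
      (fun ε : ℝ => elog2 (N ε) / ENNReal.ofReal (-Real.logb 2 ε)) (𝓝[>] (0 : ℝ)) := by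
  have hL : Tendsto (fun ε : ℝ => -Real.logb 2 ε) (𝓝[>] 0) atTop :=
    tendsto_neg_atBot_atTop.comp (Real.tendsto_logb_nhdsGT_zero one_lt_two)
  have hlim : Tendsto (fun ε : ℝ =>
      ENNReal.ofReal (t + (Real.logb 2 c - t) / -Real.logb 2 ε)) (𝓝[>] 0)
      (𝓝 (ENNReal.ofReal t)) := by
    refine ENNReal.tendsto_ofReal ?_
    simpa using (hL.const_div_atTop (Real.logb 2 c - t)).const_add t
  rw [← hlim.liminf_eq]
  refine liminf_le_liminf ?_
  filter_upwards [hN, hL.eventually_gt_atTop 0, self_mem_nhdsWithin] with ε hNε hLε hε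
  have hε : 0 < ε := hε
  have hlog : Real.logb 2 ((2 * ε) ^ (-t) * c) =
      (t + (Real.logb 2 c - t) / -Real.logb 2 ε) * -Real.logb 2 ε := by
    rw [Real.logb_mul (by positivity) hc.ne', Real.logb_rpow_eq_mul_logb_of_pos (by positivity),
      Real.logb_mul two_ne_zero hε.ne', Real.logb_self_eq_one one_lt_two, add_mul,
      div_mul_cancel₀ _ hLε.ne']
    ring
  rw [ENNReal.le_div_iff_mul_le (Or.inl (ENNReal.ofReal_pos.2 hLε).ne')
    (Or.inl ENNReal.ofReal_ne_top), ← ENNReal.ofReal_mul' hLε.le, ← hlog]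
  exact ofReal_logb_le_elog2 (by positivity) hNε

/-- Step in the proof of Proposition 1: lower bound on covering numbers and
the lower dimension from a ball-mass estimate. -/
theorem statement18 (d : ℕ) (μ : Measure (EuclideanSpace ℝ (Fin d))) [IsProbabilityMeasure μ]
    (t r₀ : ℝ) (ht : 0 < t) (hr₀ : 0 < r₀) (K : Set (EuclideanSpace ℝ (Fin d)))
    (hK : IsCompact K) (hμK : 0 < μ K)
    (hball : ∀ x ∈ K, ∀ r : ℝ, 0 < r → r ≤ r₀ → μ (Metric.ball x r) ≤ ENNReal.ofReal (r ^ t)) :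
    (∀ δ : ℝ, ENNReal.ofReal δ < μ K / 2 →
      ∀ S : Set (EuclideanSpace ℝ (Fin d)), MeasurableSet S → 1 - ENNReal.ofReal δ ≤ μ S →
        ∀ ε : ℝ, 0 < ε → 2 * ε ≤ r₀ →
          ENNReal.ofReal ((2 * ε) ^ (-t)) * μ K / 2 ≤ (coveringNumber ε S : ℝ≥0∞)) ∧
    ENNReal.ofReal t ≤ lowerDim μ := by
  have hKm : MeasurableSet K := hK.measurableSet
  have hb : ∀ ε : ℝ, 0 < ε → 2 * ε ≤ r₀ → ∀ x ∈ K,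
      μ (ball x (2 * ε)) ≤ ENNReal.ofReal ((2 * ε) ^ t) :=
    fun ε hε hεr x hx => hball x hx _ (by positivity) hεr
  refine ⟨fun δ hδ S _ hS ε hε hεr =>
    mul_measure_div_two_le_coveringNumber hKm hδ.le hS hε (hb ε hε hεr), ?_⟩
  have hc : 0 < (μ K).toReal / 2 := half_pos (ENNReal.toReal_pos hμK.ne' (measure_ne_top _ _))
  have hcK : ENNReal.ofReal ((μ K).toReal / 2) = μ K / 2 := by
    rw [ENNReal.ofReal_div_of_pos two_pos, ENNReal.ofReal_toReal (measure_ne_top _ _)]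
    simp
  refine le_trans (ofReal_le_liminf_elog2_div hc ?_)
    (le_iSup₂_of_le ((μ K).toReal / 2) hc le_rfl)
  filter_upwards [Ioc_mem_nhdsGT (half_pos hr₀)] with ε hε
  rw [ENNReal.ofReal_mul (by have := hε.1; positivity), hcK, ← mul_div_assoc]
  simp only [measureCoveringNumber, ENat.toENNReal_iInf]
  exact le_iInf₂ fun S hS => mul_measure_div_two_le_coveringNumber hKm hcK.le hS hε.1
    (hb ε hε.1 (by linarith [hε.2]))
end
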